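/- Let P be a finite set of points in ℝ² in general position, let k ≥ 0, and let {u,v} be an order-k Delaunay edge of P such that P contains points strictly on both sides of the line through u and v. Let s₁ be the point of P strictly to the left of the directed line from v to u such that the open disk bounded by the circle through u, v, s₁ contains no point of P strictly to the left of that directed line, and let s₂ be defined analogously on the right side. Then {u,v} is a useful order-k Delaunay edge if and only if both triangles u v s₁ and u v s₂ are order-k Delaunay triangles. -/

import Mathlib

open EuclideanGeometry Set

noncomputable section

/-- Points of the Euclidean plane. -/
abbrev Pt : Type := EuclideanSpace ℝ (Fin 2)

noncomputable instance : DecidableEq Pt := Classical.decEq _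

/-- `P` is in general position: no three (distinct) points collinear and
no four (distinct) points concyclic. -/
def GenPos (P : Set Pt) : Prop :=
  (∀ u v w : Pt, u ∈ P → v ∈ P → w ∈ P → u ≠ v → u ≠ w → v ≠ w →
    ¬ Collinear ℝ ({u, v, w} : Set Pt)) ∧
  (∀ u v w z : Pt, u ∈ P → v ∈ P → w ∈ P → z ∈ P →
    u ≠ v → u ≠ w → u ≠ z → v ≠ w → v ≠ z → w ≠ z →
    ¬ EuclideanGeometry.Cospherical ({u, v, w, z} : Set Pt))

/-- The (closed) triangle spanned by a finite set of points. -/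
def triSet (t : Finset Pt) : Set Pt := convexHull ℝ (t : Set Pt)

/-- `T` is a triangulation of `P`: a finite set of triangles with vertices in `P`,
every point of `P` is a vertex of some triangle, the interiors of the triangles are
pairwise disjoint, and their union is the convex hull of `P`. -/
def IsTriangulation (P : Set Pt) (T : Set (Finset Pt)) : Prop :=
  T.Finite ∧
  (∀ t ∈ T, t.card = 3 ∧ (t : Set Pt) ⊆ P) ∧
  (∀ p ∈ P, ∃ t ∈ T, p ∈ t) ∧
  (T.Pairwise fun t s => interior (triSet t) ∩ interior (triSet s) = ∅) ∧
  (⋃ t ∈ T, triSet t) = convexHull ℝ P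

/-- The triangle `t` (with vertex set `t`) is order-`k` Delaunay with respect to `P`:
the open disk bounded by its circumcircle contains at most `k` points of `P`. -/
def OrderKTri (P : Set Pt) (k : ℕ) (t : Finset Pt) : Prop :=
  ∃ z : Pt, ∃ r : ℝ, (∀ p ∈ t, dist p z = r) ∧ {p ∈ P | dist p z < r}.encard ≤ (k : ℕ∞)

/-- `T` is an order-`k` Delaunay triangulation of `P`. -/
def IsOrderDT (P : Set Pt) (k : ℕ) (T : Set (Finset Pt)) : Prop :=
  IsTriangulation P T ∧ ∀ t ∈ T, OrderKTri P k t

/-- `{u, v}` is an order-`k` Delaunay edge of `P`: some open disk having `u` and `v`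
on its boundary circle contains at most `k` points of `P`. -/
def OrderKEdge (P : Set Pt) (k : ℕ) (u v : Pt) : Prop :=
  ∃ z : Pt, ∃ r : ℝ, dist u z = r ∧ dist v z = r ∧ {p ∈ P | dist p z < r}.encard ≤ (k : ℕ∞)

/-- `{u, v}` is a useful order-`k` Delaunay edge of `P`: some order-`k` Delaunay
triangulation of `P` contains a triangle having `u` and `v` among its vertices
(i.e. having segment `uv` as a side). -/
def UsefulEdge (P : Set Pt) (k : ℕ) (u v : Pt) : Prop :=
  ∃ T, IsOrderDT P k T ∧ ∃ t ∈ T, u ∈ t ∧ v ∈ t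

/-- `{u, v}` is a Delaunay edge: it is an edge of the (unique) order-0 Delaunay
triangulation of `P`. -/
def DelaunayEdge (P : Set Pt) (u v : Pt) : Prop := UsefulEdge P 0 u v

/-- `p` lies strictly to the left of the directed line from `v` to `u`, i.e. the
triple `v, u, p` makes a counterclockwise turn. -/
def ccw (v u p : Pt) : Prop :=
  0 < (u 0 - v 0) * (p 1 - v 1) - (u 1 - v 1) * (p 0 - v 0)

/-- Twice the signed area of the triangle `a b c`. -/
def orient (a b c : Pt) : ℝ := (b 0 - a 0) * (c 1 - a 1) - (b 1 - a 1) * (c 0 - a 0)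

/-- The power of the point `p` with respect to the circle with centre `z` and radius `r`. -/
def power (z : Pt) (r : ℝ) (p : Pt) : ℝ := dist p z ^ 2 - r ^ 2

lemma power_eq (z : Pt) (r : ℝ) (p : Pt) :
    power z r p = (p 0 - z 0) ^ 2 + (p 1 - z 1) ^ 2 - r ^ 2 := by
  rw [power, EuclideanSpace.dist_eq, Real.sq_sqrt (by positivity)]
  simp [Fin.sum_univ_two, Real.dist_eq, sq_abs]

lemma power_neg_iff {z p : Pt} {r : ℝ} (hr : 0 ≤ r) : power z r p < 0 ↔ dist p z < r := by
  rw [power, sub_neg, sq_lt_sq₀ dist_nonneg hr]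

lemma power_nonneg_iff {z p : Pt} {r : ℝ} (hr : 0 ≤ r) : 0 ≤ power z r p ↔ ¬ dist p z < r := by
  rw [← power_neg_iff hr, not_lt]

lemma power_eq_zero {z p : Pt} {r : ℝ} (h : dist p z = r) : power z r p = 0 := by
  rw [power, h, sub_self]

lemma Pt.ext' {x y : Pt} (h0 : x 0 = y 0) (h1 : x 1 = y 1) : x = y := by
  ext i; fin_cases i <;> assumption

lemma comb_apply (α β γ : ℝ) (a b c : Pt) (i : Fin 2) :
    (α • a + β • b + γ • c) i = α * a i + β * b i + γ * c i := by
  simp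

lemma comb_two_apply (α β : ℝ) (a b : Pt) (i : Fin 2) :
    (α • a + β • b) i = α * a i + β * b i := by
  simp

lemma orient_rotate (a b c : Pt) : orient b c a = orient a b c := by
  unfold orient; ring

lemma orient_swap (a b c : Pt) : orient b a c = -orient a b c := by
  unfold orient; ring

lemma orient_swap_right (a b c : Pt) : orient a c b = -orient a b c := by
  unfold orient; ring

lemma orient_self_right (a b : Pt) : orient a b b = 0 := by
  unfold orient; ring

lemma orient_self_outer (a b : Pt) : orient a b a = 0 := by
  unfold orient; ring

lemma orient_sum (a b c x : Pt) :
    orient x b c + orient a x c + orient a b x = orient a b c := by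
  unfold orient; ring

lemma eq_barycentric {a b c : Pt} (h : orient a b c ≠ 0) (x : Pt) :
    x = (orient x b c / orient a b c) • a + (orient a x c / orient a b c) • b +
      (orient a b x / orient a b c) • c := by
  apply Pt.ext' <;> rw [comb_apply] <;> field_simp <;> unfold orient <;> ring

lemma barycentric_sum {a b c : Pt} (h : orient a b c ≠ 0) (x : Pt) :
    orient x b c / orient a b c + orient a x c / orient a b c + orient a b x / orient a b c =
      1 := by
  rw [← add_div, ← add_div, orient_sum, div_self h]

lemma orient_comb (a b x y : Pt) {α β : ℝ} (h : α + β = 1) :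
    orient a b (α • x + β • y) = α * orient a b x + β * orient a b y := by
  obtain rfl : β = 1 - α := by linarith
  simp only [orient, comb_two_apply]; ring

lemma orient_comb_three (a b x y z : Pt) {α β γ : ℝ} (h : α + β + γ = 1) :
    orient a b (α • x + β • y + γ • z) =
      α * orient a b x + β * orient a b y + γ * orient a b z := by
  obtain rfl : γ = 1 - α - β := by linarith
  simp only [orient, comb_apply]; ring

/-- The power of a point is a quadratic function of barycentric coordinates. -/
lemma power_comb (z : Pt) (r : ℝ) (a b c : Pt) {α β γ : ℝ} (h : α + β + γ = 1) :
    power z r (α • a + β • b + γ • c) =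
      α * power z r a + β * power z r b + γ * power z r c -
      (α * β * power a 0 b + β * γ * power b 0 c + α * γ * power a 0 c) := by
  obtain rfl : γ = 1 - α - β := by linarith
  simp only [power_eq, comb_apply]; ring

/-- The difference of two powers is an affine function. -/
lemma power_sub_comb (z z' : Pt) (r r' : ℝ) (a b c : Pt) {α β γ : ℝ} (h : α + β + γ = 1) :
    power z r (α • a + β • b + γ • c) - power z' r' (α • a + β • b + γ • c) =
      α * (power z r a - power z' r' a) + β * (power z r b - power z' r' b) +
      γ * (power z r c - power z' r' c) := by
  rw [power_comb z r a b c h, power_comb z' r' a b c h]; ring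

lemma power_sub_comb_two (z z' : Pt) (r r' : ℝ) (a b : Pt) {α β : ℝ} (h : α + β = 1) :
    power z r (α • a + β • b) - power z' r' (α • a + β • b) =
      α * (power z r a - power z' r' a) + β * (power z r b - power z' r' b) := by
  simpa using power_sub_comb z z' r r' a b a (γ := 0) (by simpa using h)

lemma power_zero_nonneg (a b : Pt) : 0 ≤ power a 0 b := by
  rw [power]; norm_num

lemma power_zero_pos {a b : Pt} (h : a ≠ b) : 0 < power a 0 b := by
  have := dist_pos.2 h.symm
  simp only [power]; norm_num; positivity

lemma power_neg_of_comb {z : Pt} {r : ℝ} {a b c : Pt} {α β γ : ℝ} (h : α + β + γ = 1)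
    (hα : 0 < α) (hβ : 0 ≤ β) (hγ : 0 ≤ γ) (ha : power z r a < 0) (hb : power z r b ≤ 0)
    (hc : power z r c ≤ 0) : power z r (α • a + β • b + γ • c) < 0 := by
  rw [power_comb z r a b c h]
  have h1 := mul_neg_of_pos_of_neg hα ha
  have h2 := mul_nonpos_of_nonneg_of_nonpos hβ hb
  have h3 := mul_nonpos_of_nonneg_of_nonpos hγ hc
  have h4 := mul_nonneg (mul_nonneg hα.le hβ) (power_zero_nonneg a b)
  have h5 := mul_nonneg (mul_nonneg hβ hγ) (power_zero_nonneg b c)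
  have h6 := mul_nonneg (mul_nonneg hα.le hγ) (power_zero_nonneg a c)
  linarith

lemma power_neg_of_comb_two {z : Pt} {r : ℝ} {a b : Pt} {α β : ℝ} (h : α + β = 1)
    (hα : 0 < α) (hβ : 0 ≤ β) (ha : power z r a < 0) (hb : power z r b ≤ 0) :
    power z r (α • a + β • b) < 0 := by
  simpa using power_neg_of_comb (c := b) (γ := 0) (by simpa using h) hα hβ le_rfl ha hb hb

lemma ne_of_orient_ne_zero {a b c : Pt} (h : orient a b c ≠ 0) : a ≠ b ∧ a ≠ c ∧ b ≠ c := by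
  refine ⟨?_, ?_, ?_⟩ <;> rintro rfl <;> apply h <;> unfold orient <;> ring

/-- A point of a triangle other than its vertices lies in the open circumdisk. -/
lemma power_neg_of_mem_triangle {z : Pt} {r : ℝ} {a b c x : Pt} (h : 0 < orient a b c)
    (ha : power z r a = 0) (hb : power z r b = 0) (hc : power z r c = 0)
    (h1 : 0 ≤ orient x b c) (h2 : 0 ≤ orient a x c) (h3 : 0 ≤ orient a b x)
    (hxa : x ≠ a) (hxb : x ≠ b) (hxc : x ≠ c) : power z r x < 0 := by
  obtain ⟨hab, hac, hbc⟩ := ne_of_orient_ne_zero h.ne'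
  have hx := eq_barycentric h.ne' x
  have hs := barycentric_sum h.ne' x
  set α := orient x b c / orient a b c
  set β := orient a x c / orient a b c
  set γ := orient a b x / orient a b c
  have hα : 0 ≤ α := by positivity
  have hβ : 0 ≤ β := by positivity
  have hγ : 0 ≤ γ := by positivity
  rw [hx, power_comb z r a b c hs, ha, hb, hc]
  have p1 := power_zero_pos hab
  have p2 := power_zero_pos hbc
  have p3 := power_zero_pos hac
  have n1 := mul_nonneg hα hβ
  have n2 := mul_nonneg hβ hγ
  have n3 := mul_nonneg hα hγ
  rcases n1.eq_or_lt with e1 | e1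
  · rcases n2.eq_or_lt with e2 | e2
    · rcases n3.eq_or_lt with e3 | e3
      · exfalso
        rcases mul_eq_zero.1 e1.symm with e | e
        · rcases mul_eq_zero.1 e2.symm with e' | e'
          · apply hxc; rw [hx]; simp [e, e', show γ = 1 by linarith]
          · apply hxb; rw [hx]; simp [e, e', show β = 1 by linarith]
        · rcases mul_eq_zero.1 e3.symm with e' | e'
          · apply hxc; rw [hx]; simp [e, e', show γ = 1 by linarith]
          · apply hxa; rw [hx]; simp [e, e', show α = 1 by linarith]
      · have := mul_pos e3 p3
        rw [← e1, ← e2]; linarith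
    · have := mul_pos e2 p2
      have := mul_nonneg n3 p3.le
      rw [← e1]; linarith
  · have := mul_pos e1 p1
    have := mul_nonneg n2 p2.le
    have := mul_nonneg n3 p3.le
    linarith

/-! ### Triangles -/

lemma mem_triSet_of_comb {a b c : Pt} {α β γ : ℝ} (h : α + β + γ = 1) (hα : 0 ≤ α) (hβ : 0 ≤ β)
    (hγ : 0 ≤ γ) : α • a + β • b + γ • c ∈ triSet {a, b, c} := by
  have := (convex_convexHull ℝ ((({a, b, c} : Finset Pt)) : Set Pt)).sum_mem
    (t := Finset.univ) (w := ![α, β, γ]) (z := ![a, b, c])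
    (by intro i _; fin_cases i <;> assumption)
    (by simpa [Fin.sum_univ_three] using h)
    (by intro i _; apply subset_convexHull; fin_cases i <;> simp)
  simpa [Fin.sum_univ_three, triSet] using this

lemma mem_triSet_iff {a b c x : Pt} (h : 0 < orient a b c) :
    x ∈ triSet {a, b, c} ↔ 0 ≤ orient x b c ∧ 0 ≤ orient a x c ∧ 0 ≤ orient a b x := by
  constructor
  · intro hx
    have hconv : Convex ℝ {y : Pt | 0 ≤ orient b c y ∧ 0 ≤ orient c a y ∧ 0 ≤ orient a b y} := by
      rintro y ⟨hy1, hy2, hy3⟩ w ⟨hw1, hw2, hw3⟩ α β hα hβ hs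
      simp only [Set.mem_ofPred_eq, orient_comb _ _ _ _ hs]
      exact ⟨by positivity, by positivity, by positivity⟩
    have hsub : (({a, b, c} : Finset Pt) : Set Pt) ⊆
        {y : Pt | 0 ≤ orient b c y ∧ 0 ≤ orient c a y ∧ 0 ≤ orient a b y} := by
      have h1 : 0 < orient b c a := by rwa [orient_rotate]
      have h2 : 0 < orient c a b := by rwa [orient_rotate]
      intro y hy
      simp only [Finset.coe_insert, Finset.coe_singleton, Set.mem_insert_iff,
        Set.mem_singleton_iff] at hy
      rcases hy with rfl | rfl | rfl
      · exact ⟨h1.le, (orient_self_right _ _).ge, (orient_self_outer _ _).ge⟩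
      · exact ⟨(orient_self_outer _ _).ge, h2.le, (orient_self_right _ _).ge⟩
      · exact ⟨(orient_self_right _ _).ge, (orient_self_outer _ _).ge, h.le⟩
    obtain ⟨h1, h2, h3⟩ := convexHull_min hsub hconv hx
    rw [orient_rotate] at h1
    rw [orient_rotate x, orient_rotate a] at h2
    exact ⟨h1, h2, h3⟩
  · rintro ⟨h1, h2, h3⟩
    rw [eq_barycentric h.ne' x]
    exact mem_triSet_of_comb (barycentric_sum h.ne' x) (by positivity) (by positivity)
      (by positivity)

lemma continuous_orient (a b : Pt) : Continuous (orient a b) := by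
  unfold orient; fun_prop

lemma mem_interior_triSet_iff {a b c x : Pt} (h : 0 < orient a b c) :
    x ∈ interior (triSet {a, b, c}) ↔ 0 < orient x b c ∧ 0 < orient a x c ∧ 0 < orient a b x := by
  constructor
  · intro hx
    have key : ∀ p : Pt, ∃ ε : ℝ, 0 < ε ∧ (1 + ε) • x + (-ε) • p ∈ triSet {a, b, c} := by
      intro p
      have hc : Filter.Tendsto (fun ε : ℝ => (1 + ε) • x + (-ε) • p) (nhds 0) (nhds x) := by
        have : Continuous (fun ε : ℝ => (1 + ε) • x + (-ε) • p) := by fun_prop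
        simpa using this.tendsto 0
      have h1 := hc.eventually (mem_interior_iff_mem_nhds.1 hx)
      have h2 := (h1.filter_mono nhdsWithin_le_nhds : ∀ᶠ ε in nhdsWithin (0 : ℝ) (Set.Ioi 0), _)
      obtain ⟨ε, hε, hε'⟩ := (h2.and self_mem_nhdsWithin).exists
      exact ⟨ε, hε', hε⟩
    refine ⟨?_, ?_, ?_⟩
    · obtain ⟨ε, hε, hm⟩ := key a
      have := ((mem_triSet_iff h).1 hm).1
      rw [← orient_rotate, orient_comb _ _ _ _ (by ring)] at this
      rw [orient_rotate a, orient_rotate x] at this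
      nlinarith
    · obtain ⟨ε, hε, hm⟩ := key b
      have := ((mem_triSet_iff h).1 hm).2.1
      rw [← orient_rotate, ← orient_rotate, orient_comb _ _ _ _ (by ring)] at this
      rw [← orient_rotate a x, ← orient_rotate x c]
      rw [← orient_rotate a b, ← orient_rotate b c] at h
      nlinarith
    · obtain ⟨ε, hε, hm⟩ := key c
      have := ((mem_triSet_iff h).1 hm).2.2
      rw [orient_comb _ _ _ _ (by ring)] at this
      nlinarith
  · intro hx
    have ho : IsOpen {y : Pt | 0 < orient b c y ∧ 0 < orient c a y ∧ 0 < orient a b y} :=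
      (isOpen_lt continuous_const (continuous_orient b c)).inter
        ((isOpen_lt continuous_const (continuous_orient c a)).inter
          (isOpen_lt continuous_const (continuous_orient a b)))
    refine interior_maximal ?_ ho ?_
    · rintro y ⟨h1, h2, h3⟩
      rw [mem_triSet_iff h]
      rw [orient_rotate] at h1
      rw [← orient_rotate a y, ← orient_rotate y c]
      exact ⟨h1.le, h2.le, h3.le⟩
    · obtain ⟨h1, h2, h3⟩ := hx
      rw [← orient_rotate] at h1
      rw [← orient_rotate, ← orient_rotate] at h2
      exact ⟨h1, h2, h3⟩

lemma isClosed_triSet (t : Finset Pt) : IsClosed (triSet t) :=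
  (t.finite_toSet.isCompact_convexHull ℝ).isClosed

lemma interior_triSet_nonempty {a b c : Pt} (h : 0 < orient a b c) :
    (interior (triSet {a, b, c})).Nonempty := by
  refine ⟨(1 / 3 : ℝ) • a + (1 / 3 : ℝ) • b + (1 / 3 : ℝ) • c, ?_⟩
  rw [mem_interior_triSet_iff h, ← orient_rotate _ b c, ← orient_rotate a, ← orient_rotate _ c a,
    orient_comb_three _ _ _ _ _ (by norm_num), orient_comb_three _ _ _ _ _ (by norm_num),
    orient_comb_three _ _ _ _ _ (by norm_num)]
  have h1 : 0 < orient b c a := by rwa [orient_rotate]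
  have h2 : 0 < orient c a b := by rwa [orient_rotate]
  simp only [orient_self_right, orient_self_outer]
  refine ⟨?_, ?_, ?_⟩ <;> linarith

lemma triSet_subset_closure_interior {a b c : Pt} (h : 0 < orient a b c) :
    triSet {a, b, c} ⊆ closure (interior (triSet {a, b, c})) := by
  have hconv : Convex ℝ (triSet {a, b, c}) := convex_convexHull ℝ _
  rw [hconv.closure_interior_eq_closure_of_nonempty_interior (interior_triSet_nonempty h)]
  exact subset_closure

/-! ### General position -/

lemma exists_comb_of_orient_eq_zero {u v w : Pt} (huv : u ≠ v) (h0 : orient u v w = 0) :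
    ∃ σ : ℝ, w = (1 - σ) • u + σ • v := by
  have hd : (v 0 - u 0) ^ 2 + (v 1 - u 1) ^ 2 ≠ 0 := by
    simpa [power_eq] using (power_zero_pos huv).ne'
  refine ⟨((w 0 - u 0) * (v 0 - u 0) + (w 1 - u 1) * (v 1 - u 1)) /
      ((v 0 - u 0) ^ 2 + (v 1 - u 1) ^ 2), ?_⟩
  unfold orient at h0
  apply Pt.ext' <;> rw [comb_two_apply, ← sub_eq_zero] <;> field_simp
  · linear_combination -(v 1 - u 1) * h0
  · linear_combination (v 0 - u 0) * h0

lemma GenPos.orient_ne_zero {P : Set Pt} (h : GenPos P) {u v w : Pt} (hu : u ∈ P) (hv : v ∈ P)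
    (hw : w ∈ P) (huv : u ≠ v) (huw : u ≠ w) (hvw : v ≠ w) : orient u v w ≠ 0 := by
  intro h0
  apply h.1 u v w hu hv hw huv huw hvw
  obtain ⟨σ, rfl⟩ := exists_comb_of_orient_eq_zero huv h0
  rw [collinear_iff_of_mem (p₀ := u) (by simp)]
  refine ⟨v - u, ?_⟩
  intro p hp
  simp only [Set.mem_insert_iff, Set.mem_singleton_iff] at hp
  rcases hp with rfl | rfl | rfl
  · exact ⟨0, by simp⟩
  · exact ⟨1, by simp⟩
  · exact ⟨σ, by rw [vadd_eq_add]; module⟩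

lemma GenPos.mono {P Q : Set Pt} (h : GenPos P) (hQ : Q ⊆ P) : GenPos Q :=
  ⟨fun u v w hu hv hw => h.1 u v w (hQ hu) (hQ hv) (hQ hw),
    fun u v w z hu hv hw hz => h.2 u v w z (hQ hu) (hQ hv) (hQ hw) (hQ hz)⟩

lemma GenPos.mem_of_concyclic {P : Set Pt} (h : GenPos P) {a b c d z : Pt} {r : ℝ} (ha : a ∈ P)
    (hb : b ∈ P) (hc : c ∈ P) (hd : d ∈ P) (hab : a ≠ b) (hac : a ≠ c) (hbc : b ≠ c)
    (ra : dist a z = r) (rb : dist b z = r) (rc : dist c z = r) (rd : dist d z = r) :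
    d ∈ ({a, b, c} : Finset Pt) := by
  by_contra hn
  simp only [Finset.mem_insert, Finset.mem_singleton, not_or] at hn
  refine h.2 a b c d ha hb hc hd hab hac (Ne.symm hn.1) hbc (Ne.symm hn.2.1) (Ne.symm hn.2.2)
    ⟨z, r, ?_⟩
  intro p hp
  simp only [Set.mem_insert_iff, Set.mem_singleton_iff] at hp
  rcases hp with rfl | rfl | rfl | rfl <;> assumption

lemma GenPos.exists_ccw_of_mem {P : Set Pt} (h : GenPos P) {t : Finset Pt} (ht : t.card = 3)
    (hP : (t : Set Pt) ⊆ P) {s : Pt} (hs : s ∈ t) :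
    ∃ a b, a ∈ P ∧ b ∈ P ∧ t = {s, a, b} ∧ 0 < orient s a b := by
  have hc : (t.erase s).card = 2 := by rw [Finset.card_erase_of_mem hs, ht]
  obtain ⟨a, b, hab, he⟩ := Finset.card_eq_two.1 hc
  have htt : t = {s, a, b} := by rw [← Finset.insert_erase hs, he]
  have hsa : s ≠ a := by
    rintro rfl; exact Finset.notMem_erase s t (by rw [he]; simp)
  have hsb : s ≠ b := by
    rintro rfl; exact Finset.notMem_erase s t (by rw [he]; simp)
  have hsP : s ∈ P := hP (by simp [htt])
  have haP : a ∈ P := hP (by simp [htt])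
  have hbP : b ∈ P := hP (by simp [htt])
  rcases lt_or_gt_of_ne (h.orient_ne_zero hsP haP hbP hsa hsb hab) with h0 | h0
  · exact ⟨b, a, hbP, haP, by rw [htt, Finset.pair_comm], by rw [orient_swap_right]; linarith⟩
  · exact ⟨a, b, haP, hbP, htt, h0⟩

lemma GenPos.exists_ccw {P : Set Pt} (h : GenPos P) {t : Finset Pt} (ht : t.card = 3)
    (hP : (t : Set Pt) ⊆ P) :
    ∃ a b c, a ∈ P ∧ b ∈ P ∧ c ∈ P ∧ t = {a, b, c} ∧ 0 < orient a b c := by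
  obtain ⟨s, hs⟩ : t.Nonempty := by rw [← Finset.card_pos, ht]; norm_num
  obtain ⟨a, b, ha, hb, he, ho⟩ := h.exists_ccw_of_mem ht hP hs
  exact ⟨s, a, b, hP hs, ha, hb, he, ho⟩

lemma card_triple {a b c : Pt} (h : orient a b c ≠ 0) : ({a, b, c} : Finset Pt).card = 3 := by
  obtain ⟨h1, h2, h3⟩ := ne_of_orient_ne_zero h
  exact Finset.card_eq_three.2 ⟨a, b, c, h1, h2, h3, rfl⟩

/-- The circumcentre of a nondegenerate triangle. -/
def circumcentre (a b c : Pt) : Pt :=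
  !₂[a 0 + ((c 1 - a 1) * ((b 0 - a 0) ^ 2 + (b 1 - a 1) ^ 2) -
        (b 1 - a 1) * ((c 0 - a 0) ^ 2 + (c 1 - a 1) ^ 2)) / (2 * orient a b c),
    a 1 + ((b 0 - a 0) * ((c 0 - a 0) ^ 2 + (c 1 - a 1) ^ 2) -
        (c 0 - a 0) * ((b 0 - a 0) ^ 2 + (b 1 - a 1) ^ 2)) / (2 * orient a b c)]

lemma dist_eq_of_power_eq {z z' a b : Pt} (h : power z 0 a = power z' 0 b) :
    dist a z = dist b z' := by
  simp only [power] at h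
  exact (sq_eq_sq₀ dist_nonneg dist_nonneg).1 (by linarith)

lemma dist_circumcentre {a b c : Pt} (h : orient a b c ≠ 0) :
    dist b (circumcentre a b c) = dist a (circumcentre a b c) ∧
      dist c (circumcentre a b c) = dist a (circumcentre a b c) := by
  constructor <;> apply dist_eq_of_power_eq <;> simp only [power_eq, circumcentre,
    Matrix.cons_val_zero, Matrix.cons_val_one] <;> rw [← sub_eq_zero] <;>
    field_simp <;> unfold orient <;> ring

/-! ### Delaunay triangles -/

/-- Moving a vertex of a triangle into its open circumdisk increases the power of the
points of the new triangle that are off the fixed side. -/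
lemma power_lt_power_of_replace {z z' b c q x : Pt} {r r' : ℝ} (hb : power z r b = 0)
    (hc : power z r c = 0) (hq : power z r q < 0) (hq' : power z' r' q = 0)
    (hb' : power z' r' b = 0) (hc' : power z' r' c = 0) (ho : 0 < orient q b c)
    (hx : 0 < orient x b c) : power z r x < power z' r' x := by
  have h1 := power_sub_comb z z' r r' q b c (barycentric_sum ho.ne' x)
  rw [← eq_barycentric ho.ne' x, hb, hc, hq', hb', hc'] at h1
  have := mul_neg_of_pos_of_neg (div_pos hx ho) hq
  linarith

lemma exists_dominant_ratio {w₁ w₂ w₃ v₁ v₂ v₃ : ℝ} (h₁ : 0 < w₁) (h₂ : 0 < w₂) (h₃ : 0 < w₃)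
    (hv : 0 < v₁ + v₂ + v₃) :
    (0 < v₁ ∧ w₁ * v₂ ≤ w₂ * v₁ ∧ w₁ * v₃ ≤ w₃ * v₁) ∨
    (0 < v₂ ∧ w₂ * v₃ ≤ w₃ * v₂ ∧ w₂ * v₁ ≤ w₁ * v₂) ∨
    (0 < v₃ ∧ w₃ * v₁ ≤ w₁ * v₃ ∧ w₃ * v₂ ≤ w₂ * v₃) := by
  have key : ∀ {a b c x y z : ℝ}, 0 < a → 0 < b → 0 < c → 0 < x + y + z → a * y ≤ b * x →
      a * z ≤ c * x → 0 < x := by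
    intro a b c x y z ha hb hc hs h1 h2
    by_contra hx
    push Not at hx
    have hy : y ≤ 0 := by
      by_contra hy; push Not at hy
      have := mul_pos ha hy
      have := mul_nonpos_of_nonneg_of_nonpos hb.le hx
      linarith
    have hz : z ≤ 0 := by
      by_contra hz; push Not at hz
      have := mul_pos ha hz
      have := mul_nonpos_of_nonneg_of_nonpos hc.le hx
      linarith
    linarith
  have tr : ∀ {a b c x y z : ℝ}, 0 < a → 0 < b → 0 < c → a * y ≤ b * x → b * z ≤ c * y →
      a * z ≤ c * x := by
    intro a b c x y z ha hb hc h1 h2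
    have e1 := mul_le_mul_of_nonneg_left h1 hc.le
    have e2 := mul_le_mul_of_nonneg_left h2 ha.le
    have : b * (a * z) ≤ b * (c * x) := by linarith
    exact le_of_mul_le_mul_left this hb
  rcases le_total (w₁ * v₂) (w₂ * v₁) with a | a
  · rcases le_total (w₁ * v₃) (w₃ * v₁) with b | b
    · exact Or.inl ⟨key h₁ h₂ h₃ hv a b, a, b⟩
    · have c := tr h₃ h₁ h₂ b a
      exact Or.inr (Or.inr ⟨key h₃ h₁ h₂ (by linarith) b c, b, c⟩)
  · rcases le_total (w₂ * v₃) (w₃ * v₂) with b | b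
    · exact Or.inr (Or.inl ⟨key h₂ h₃ h₁ (by linarith) b a, b, a⟩)
    · have c := tr h₃ h₂ h₁ b a
      exact Or.inr (Or.inr ⟨key h₃ h₁ h₂ (by linarith) c b, c, b⟩)

/-- The point `x` avoids `P` and all lines spanned by pairs of points of `P`. -/
def Generic (P : Set Pt) (x : Pt) : Prop :=
  x ∉ P ∧ ∀ p ∈ P, ∀ q ∈ P, p ≠ q → orient p q x ≠ 0

lemma Generic.mono {P Q : Set Pt} {x : Pt} (h : Generic P x) (hQ : Q ⊆ P) : Generic Q x :=
  ⟨fun hx => h.1 (hQ hx), fun p hp q hq => h.2 p (hQ hp) q (hQ hq)⟩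

lemma Generic.pos {P : Set Pt} {x p q : Pt} (h : Generic P x) (hp : p ∈ P) (hq : q ∈ P)
    (hpq : p ≠ q) (h0 : 0 ≤ orient p q x) : 0 < orient p q x :=
  lt_of_le_of_ne h0 (h.2 p hp q hq hpq).symm

lemma Generic.exists_triangle {Q : Set Pt} (hgp : GenPos Q) {x : Pt} (hx : Generic Q x)
    (hxQ : x ∈ convexHull ℝ Q) : ∃ a ∈ Q, ∃ b ∈ Q, ∃ c ∈ Q,
      0 < orient x b c ∧ 0 < orient a x c ∧ 0 < orient a b x := by
  rw [convexHull_eq_union] at hxQ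
  simp only [Set.mem_iUnion] at hxQ
  obtain ⟨t, htQ, hind, hxt⟩ := hxQ
  have hcard : t.card ≤ 3 := by
    have h1 := hind.card_le_finrank_succ
    have h2 := Submodule.finrank_le (vectorSpan ℝ (Set.range ((↑) : t → Pt)))
    rw [finrank_euclideanSpace_fin] at h2
    rw [Fintype.card_coe] at h1
    omega
  have h0 : t.card ≠ 0 := by
    intro h; rw [Finset.card_eq_zero] at h; simp [h] at hxt
  have h1 : t.card ≠ 1 := by
    intro h; obtain ⟨p, rfl⟩ := Finset.card_eq_one.1 h
    simp only [Finset.coe_singleton, convexHull_singleton, Set.mem_singleton_iff] at hxt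
    exact hx.1 (hxt ▸ htQ (by simp))
  have h2 : t.card ≠ 2 := by
    intro h; obtain ⟨p, q, hpq, rfl⟩ := Finset.card_eq_two.1 h
    simp only [Finset.coe_insert, Finset.coe_singleton, convexHull_pair] at hxt
    obtain ⟨α, β, -, -, hs, rfl⟩ := hxt
    apply hx.2 p (htQ (by simp)) q (htQ (by simp)) hpq
    rw [orient_comb _ _ _ _ hs, orient_self_outer, orient_self_right]; ring
  obtain ⟨a, b, c, ha, hb, hc, rfl, ho⟩ := hgp.exists_ccw (by omega : t.card = 3) htQ
  obtain ⟨hab, hac, hbc⟩ := ne_of_orient_ne_zero ho.ne'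
  obtain ⟨p1, p2, p3⟩ := (mem_triSet_iff ho).1 hxt
  refine ⟨a, ha, b, hb, c, hc, ?_, ?_, hx.pos ha hb hab p3⟩
  · rw [← orient_rotate] at p1 ⊢
    exact hx.pos hb hc hbc p1
  · rw [← orient_rotate, ← orient_rotate] at p2 ⊢
    exact hx.pos hc ha hac.symm p2

/-- Every generic point of the convex hull of `Q` lies in a Delaunay triangle of `Q`. -/
lemma Generic.exists_delaunay {Q : Set Pt} (hfin : Q.Finite) (hgp : GenPos Q) {x : Pt}
    (hx : Generic Q x) (hxQ : x ∈ convexHull ℝ Q) :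
    ∃ a ∈ Q, ∃ b ∈ Q, ∃ c ∈ Q, 0 < orient a b c ∧ x ∈ interior (triSet {a, b, c}) ∧
      ∃ z r, 0 ≤ r ∧ dist a z = r ∧ dist b z = r ∧ dist c z = r ∧ ∀ p ∈ Q, 0 ≤ power z r p := by
  set S : Set (Pt × Pt × Pt) := {t | t ∈ Q ×ˢ Q ×ˢ Q ∧ 0 < orient x t.2.1 t.2.2 ∧
    0 < orient t.1 x t.2.2 ∧ 0 < orient t.1 t.2.1 x} with hS
  have hSfin : S.Finite := (hfin.prod (hfin.prod hfin)).subset fun t ht => ht.1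
  have hSne : S.Nonempty := by
    obtain ⟨a, ha, b, hb, c, hc, h⟩ := hx.exists_triangle hgp hxQ
    exact ⟨(a, b, c), ⟨ha, hb, hc⟩, h⟩
  obtain ⟨⟨a, b, c⟩, ⟨⟨ha, hb, hc⟩, w1, w2, w3⟩, hmax⟩ := Set.exists_max_image S
    (fun t => power (circumcentre t.1 t.2.1 t.2.2) (dist t.1 (circumcentre t.1 t.2.1 t.2.2)) x)
    hSfin hSne
  simp only at ha hb hc w1 w2 w3 hmax
  have ho : 0 < orient a b c := by rw [← orient_sum a b c x]; positivity
  obtain ⟨db, dc⟩ := dist_circumcentre ho.ne'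
  refine ⟨a, ha, b, hb, c, hc, ho, (mem_interior_triSet_iff ho).2 ⟨w1, w2, w3⟩,
    circumcentre a b c, _, dist_nonneg, rfl, db, dc, ?_⟩
  intro q hq
  by_contra! hlt
  have pa := power_eq_zero (rfl : dist a (circumcentre a b c) = dist a (circumcentre a b c))
  have pb := power_eq_zero db
  have pc := power_eq_zero dc
  have hqa : q ≠ a := by rintro rfl; linarith
  have hqb : q ≠ b := by rintro rfl; linarith
  have hqc : q ≠ c := by rintro rfl; linarith
  have hsum := orient_sum a b c q
  rcases exists_dominant_ratio (v₁ := orient q b c) (v₂ := orient a q c) (v₃ := orient a b q)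
    w1 w2 w3 (by rw [hsum]; exact ho) with ⟨hv, i1, i2⟩ | ⟨hv, i1, i2⟩ | ⟨hv, i1, i2⟩
  · have e1 : orient q x c * orient a b c =
        orient a x c * orient q b c - orient x b c * orient a q c := by unfold orient; ring
    have e2 : orient q b x * orient a b c =
        orient a b x * orient q b c - orient x b c * orient a b q := by unfold orient; ring
    have f1 : 0 ≤ orient q x c := nonneg_of_mul_nonneg_left (by linarith) ho
    have f2 : 0 ≤ orient q b x := nonneg_of_mul_nonneg_left (by linarith) ho
    have g1 : 0 < orient q x c := by
      rw [← orient_rotate, ← orient_rotate] at f1 ⊢; exact hx.pos hc hq hqc.symm f1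
    have g2 : 0 < orient q b x := hx.pos hq hb hqb f2
    have := hmax (q, b, c) ⟨⟨hq, hb, hc⟩, w1, g1, g2⟩
    obtain ⟨db', dc'⟩ := dist_circumcentre hv.ne'
    exact this.not_gt (power_lt_power_of_replace pb pc hlt (power_eq_zero rfl)
      (power_eq_zero db') (power_eq_zero dc') hv w1)
  · have e1 : orient a q x * orient a b c =
        orient a b x * orient a q c - orient a x c * orient a b q := by unfold orient; ring
    have e2 : orient x q c * orient a b c =
        orient x b c * orient a q c - orient a x c * orient q b c := by unfold orient; ring
    have f1 : 0 ≤ orient a q x := nonneg_of_mul_nonneg_left (by linarith) ho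
    have f2 : 0 ≤ orient x q c := nonneg_of_mul_nonneg_left (by linarith) ho
    have g1 : 0 < orient a q x := hx.pos ha hq hqa.symm f1
    have g2 : 0 < orient x q c := by
      rw [← orient_rotate] at f2 ⊢; exact hx.pos hq hc hqc f2
    have := hmax (a, q, c) ⟨⟨ha, hq, hc⟩, g2, w2, g1⟩
    obtain ⟨db', dc'⟩ := dist_circumcentre hv.ne'
    exact this.not_gt (power_lt_power_of_replace pc pa hlt (power_eq_zero db')
      (power_eq_zero dc') (power_eq_zero rfl) (by rwa [orient_rotate])
      (by rwa [orient_rotate]))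
  · have e1 : orient x b q * orient a b c =
        orient x b c * orient a b q - orient a b x * orient q b c := by unfold orient; ring
    have e2 : orient a x q * orient a b c =
        orient a x c * orient a b q - orient a b x * orient a q c := by unfold orient; ring
    have f1 : 0 ≤ orient x b q := nonneg_of_mul_nonneg_left (by linarith) ho
    have f2 : 0 ≤ orient a x q := nonneg_of_mul_nonneg_left (by linarith) ho
    have g1 : 0 < orient x b q := by
      rw [← orient_rotate] at f1 ⊢; exact hx.pos hb hq hqb.symm f1
    have g2 : 0 < orient a x q := by
      rw [← orient_rotate, ← orient_rotate] at f2 ⊢; exact hx.pos hq ha hqa f2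
    have := hmax (a, b, q) ⟨⟨ha, hb, hq⟩, g1, g2, w3⟩
    obtain ⟨db', dc'⟩ := dist_circumcentre hv.ne'
    exact this.not_gt (power_lt_power_of_replace pa pb hlt (power_eq_zero dc')
      (power_eq_zero rfl) (power_eq_zero db') (by rwa [← orient_rotate])
      (by rwa [← orient_rotate]))

/-! ### Triangles of a triangulation -/

/-- A point of an open disk beyond the chord `v u`, as seen from a point `s` of the circle, is
seen through the chord. -/
lemma orient_pos_of_power_neg {z s u v q : Pt} {r : ℝ} (ho : 0 < orient v u s)
    (hu : power z r u = 0) (hv : power z r v = 0) (hs : power z r s = 0)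
    (hq : power z r q < 0) (hr : orient v u q < 0) : 0 < orient s v q ∧ 0 < orient s q u := by
  have hsum := orient_sum s v u q
  have e1 : orient q v u = orient v u q := (orient_rotate q v u).symm
  have e2 : orient s v u = orient v u s := (orient_rotate s v u).symm
  have e3 : orient q u v = -orient v u q := by unfold orient; ring
  constructor
  · by_contra! h
    have hp : 0 < orient q u s := by
      have : orient q u s = orient s q u := by unfold orient; ring
      linarith
    have e4 : orient q v s = -orient s v q := by unfold orient; ring
    have := power_neg_of_comb (z := z) (r := r) (barycentric_sum hp.ne' v) (div_pos ho hp)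
      (div_nonneg (by linarith) hp.le) (div_nonneg (by linarith) hp.le) hq hu.le hs.le
    rw [← eq_barycentric hp.ne' v] at this
    linarith
  · by_contra! h
    have hp : 0 < orient q s v := by
      have : orient q s v = orient s v q := by unfold orient; ring
      linarith
    have e4 : orient q s u = -orient s q u := by unfold orient; ring
    have e5 : orient u s v = orient v u s := by unfold orient; ring
    have := power_neg_of_comb (z := z) (r := r) (barycentric_sum hp.ne' u)
      (div_pos (by linarith) hp) (div_nonneg (by linarith) hp.le)
      (div_nonneg (by linarith) hp.le) hq hs.le hv.le
    rw [← eq_barycentric hp.ne' u] at this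
    linarith

/-- A segment joining both sides of a line meets this line. -/
lemma exists_mem_openSegment_orient_eq_zero {u v x p : Pt} (hx : 0 < orient v u x)
    (hp : orient v u p < 0) : ∃ y ∈ openSegment ℝ x p, orient v u y = 0 := by
  have hd : 0 < orient v u x - orient v u p := by linarith
  have hs : -orient v u p / (orient v u x - orient v u p) +
      orient v u x / (orient v u x - orient v u p) = 1 := by field_simp; ring
  refine ⟨_, ⟨_, _, div_pos (by linarith) hd, div_pos hx hd, hs, rfl⟩, ?_⟩
  rw [orient_comb _ _ _ _ hs]; field_simp; ring

lemma exists_mem_openSegments {s u v q : Pt} (hs : 0 < orient v u s) (hq : orient v u q < 0)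
    (h1 : 0 < orient s v q) (h2 : 0 < orient s q u) :
    ∃ y ∈ openSegment ℝ s q, y ∈ openSegment ℝ v u := by
  obtain ⟨y, hy, hy0⟩ := exists_mem_openSegment_orient_eq_zero hs hq
  refine ⟨y, hy, ?_⟩
  obtain ⟨α, β, hα, hβ, hab, rfl⟩ := hy
  set y := α • s + β • q with hy
  have ho : 0 < orient s v u := by rwa [← orient_rotate]
  have e0 : orient y v u = 0 := by rwa [← orient_rotate]
  have e1 : orient s v y = β * orient s v q := by
    rw [orient_comb _ _ _ _ hab, orient_self_outer]; ring
  have e2 : orient s y u = β * orient s q u := by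
    rw [← orient_rotate, ← orient_rotate, orient_comb _ _ _ _ hab, orient_self_right,
      orient_rotate, orient_rotate]
    ring
  have hb := eq_barycentric ho.ne' y
  have hsum := barycentric_sum ho.ne' y
  rw [e0, e1, e2] at hb hsum
  rw [zero_div, zero_add] at hsum
  exact ⟨_, _, by positivity, by positivity, hsum,
    by rw [zero_div, zero_smul, zero_add] at hb; exact hb.symm⟩

/-- Triangles with disjoint interiors are separated by a line. -/
lemma exists_separating {a b c a' b' c' : Pt} (h : 0 < orient a b c) (h' : 0 < orient a' b' c')
    (hd : interior (triSet {a, b, c}) ∩ interior (triSet {a', b', c'}) = ∅) :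
    ∃ (f : Pt →L[ℝ] ℝ) (w : ℝ), (∀ x ∈ triSet {a, b, c}, f x ≤ w) ∧
      (∀ x ∈ triSet {a', b', c'}, w ≤ f x) ∧
      ∀ p q r : Pt, f p = w → f q = w → f r = w → orient p q r = 0 := by
  obtain ⟨f, w, h1, h2⟩ := geometric_hahn_banach_open
    (convex_convexHull ℝ (({a, b, c} : Finset Pt) : Set Pt)).interior isOpen_interior
    (convex_convexHull ℝ (({a', b', c'} : Finset Pt) : Set Pt)).interior
    (Set.disjoint_iff_inter_eq_empty.2 hd)
  refine ⟨f, w, ?_, ?_, ?_⟩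
  · intro x hx
    have hcl : IsClosed {y : Pt | f y ≤ w} := isClosed_le f.continuous continuous_const
    exact closure_minimal (fun y hy => (h1 y hy).le) hcl (triSet_subset_closure_interior h hx)
  · intro x hx
    have hcl : IsClosed {y : Pt | w ≤ f y} := isClosed_le continuous_const f.continuous
    exact closure_minimal (fun y hy => h2 y hy) hcl (triSet_subset_closure_interior h' hx)
  · intro p q r hp hq hr
    by_contra hne
    obtain ⟨x, hx⟩ := interior_triSet_nonempty h
    have hlt := h1 x hx
    have hs := barycentric_sum hne x
    rw [eq_barycentric hne x] at hlt
    simp only [map_add, map_smul, hp, hq, hr, smul_eq_mul, ← add_mul, hs, one_mul] at hlt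
    exact lt_irrefl _ hlt

lemma mem_triSet {t : Finset Pt} {p : Pt} (hp : p ∈ t) : p ∈ triSet t :=
  subset_convexHull ℝ _ hp

lemma IsTriangulation.mem_of_mem_triSet {P : Set Pt} {T : Set (Finset Pt)} (hgp : GenPos P)
    (hT : IsTriangulation P T) {t : Finset Pt} (ht : t ∈ T) {p : Pt} (hp : p ∈ P)
    (hpt : p ∈ triSet t) : p ∈ t := by
  obtain ⟨-, hsub, hcov, hdisj, -⟩ := hT
  by_contra hn
  obtain ⟨t', ht', hpt'⟩ := hcov p hp
  have hne : t ≠ t' := by rintro rfl; exact hn hpt'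
  obtain ⟨a, b, c, ha, hb, hc, rfl, ho⟩ := hgp.exists_ccw (hsub t ht).1 (hsub t ht).2
  obtain ⟨a', b', c', -, -, -, rfl, ho'⟩ := hgp.exists_ccw (hsub t' ht').1 (hsub t' ht').2
  obtain ⟨f, w, h1, h2, h3⟩ := exists_separating ho ho' (hdisj ht ht' hne)
  have hfp : f p = w := le_antisymm (h1 p hpt) (h2 p (mem_triSet hpt'))
  simp only [Finset.mem_insert, Finset.mem_singleton, not_or] at hn
  obtain ⟨hab, hac, hbc⟩ := ne_of_orient_ne_zero ho.ne'
  obtain ⟨p1, p2, p3⟩ := (mem_triSet_iff ho).1 hpt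
  have q1 := p1.lt_of_ne (hgp.orient_ne_zero hp hb hc hn.2.1 hn.2.2 hbc).symm
  have q2 := p2.lt_of_ne (hgp.orient_ne_zero ha hp hc (Ne.symm hn.1) hac hn.2.2).symm
  have q3 := p3.lt_of_ne (hgp.orient_ne_zero ha hb hp hab (Ne.symm hn.1) (Ne.symm hn.2.1)).symm
  have fa := h1 a (mem_triSet (by simp))
  have fb := h1 b (mem_triSet (by simp))
  have fc := h1 c (mem_triSet (by simp))
  have hs := orient_sum a b c p
  have hcomb : orient p b c * f a + orient a p c * f b + orient a b p * f c =
      orient a b c * w := by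
    have hb := congrArg f (eq_barycentric ho.ne' p)
    simp only [map_add, map_smul, smul_eq_mul, hfp] at hb
    rw [hb]; field_simp
  have k1 := mul_nonneg q1.le (sub_nonneg.2 fa)
  have k2 := mul_nonneg q2.le (sub_nonneg.2 fb)
  have k3 := mul_nonneg q3.le (sub_nonneg.2 fc)
  have hz : orient p b c * (w - f a) + orient a p c * (w - f b) + orient a b p * (w - f c) = 0 := by
    linear_combination w * hs - hcomb
  refine ho.ne' (h3 a b c ?_ ?_ ?_)
  · have : w - f a = 0 := (mul_eq_zero.1 (by linarith)).resolve_left q1.ne'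
    linarith
  · have : w - f b = 0 := (mul_eq_zero.1 (by linarith)).resolve_left q2.ne'
    linarith
  · have : w - f c = 0 := (mul_eq_zero.1 (by linarith)).resolve_left q3.ne'
    linarith

/-- Sides of distinct triangles of a triangulation do not cross. -/
lemma IsTriangulation.not_crossing {P : Set Pt} {T : Set (Finset Pt)} (hgp : GenPos P)
    (hT : IsTriangulation P T) {t t' : Finset Pt} (ht : t ∈ T) (ht' : t' ∈ T) (hne : t ≠ t')
    {s q u v y : Pt} (hs : s ∈ t) (hq : q ∈ t) (hu : u ∈ t') (hv : v ∈ t')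
    (hy : y ∈ openSegment ℝ s q) (hy' : y ∈ openSegment ℝ v u) : orient v u q = 0 := by
  obtain ⟨-, hsub, -, hdisj, -⟩ := hT
  obtain ⟨a, b, c, -, -, -, rfl, ho⟩ := hgp.exists_ccw (hsub t ht).1 (hsub t ht).2
  obtain ⟨a', b', c', -, -, -, rfl, ho'⟩ := hgp.exists_ccw (hsub t' ht').1 (hsub t' ht').2
  obtain ⟨f, w, h1, h2, h3⟩ := exists_separating ho ho' (hdisj ht ht' hne)
  have fs := h1 s (mem_triSet hs)
  have fq := h1 q (mem_triSet hq)
  have fu := h2 u (mem_triSet hu)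
  have fv := h2 v (mem_triSet hv)
  obtain ⟨α, β, hα, hβ, hab, rfl⟩ := hy
  obtain ⟨γ, δ, hγ, hδ, hcd, he⟩ := hy'
  have hf := congrArg f he
  simp only [map_add, map_smul, smul_eq_mul] at hf
  obtain rfl : α = 1 - β := by linarith
  obtain rfl : γ = 1 - δ := by linarith
  have k1 := mul_nonneg hα.le (sub_nonneg.2 fs)
  have k2 := mul_nonneg hβ.le (sub_nonneg.2 fq)
  have k3 := mul_nonneg hγ.le (sub_nonneg.2 fv)
  have k4 := mul_nonneg hδ.le (sub_nonneg.2 fu)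
  refine h3 v u q ?_ ?_ ?_
  · have : f v - w = 0 := (mul_eq_zero.1 (by linarith)).resolve_left hγ.ne'
    linarith
  · have : f u - w = 0 := (mul_eq_zero.1 (by linarith)).resolve_left hδ.ne'
    linarith
  · have : w - f q = 0 := (mul_eq_zero.1 (by linarith)).resolve_left hβ.ne'
    linarith

/-- Near a point `s` of `P`, the ray from `s` towards a point `m` of the convex hull runs inside
a triangle of the triangulation having `s` as a vertex. -/
lemma IsTriangulation.exists_mem_ray {P : Set Pt} {T : Set (Finset Pt)} (hgp : GenPos P)
    (hT : IsTriangulation P T) {s m : Pt} (hs : s ∈ P) (hm : m ∈ convexHull ℝ P) :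
    ∃ t ∈ T, s ∈ t ∧ ∃ ε : ℝ, 0 < ε ∧ (1 - ε) • s + ε • m ∈ triSet t := by
  have hlim : Filter.Tendsto (fun ε : ℝ => (1 - ε) • s + ε • m) (nhdsWithin 0 (Set.Ioi 0))
      (nhds s) := by
    have : Continuous (fun ε : ℝ => (1 - ε) • s + ε • m) := by fun_prop
    simpa using (this.tendsto 0).mono_left nhdsWithin_le_nhds
  have hpos : ∀ᶠ ε : ℝ in nhdsWithin 0 (Set.Ioi 0), 0 < ε := self_mem_nhdsWithin
  have hlt : ∀ᶠ ε : ℝ in nhdsWithin 0 (Set.Ioi 0), ε < 1 :=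
    nhdsWithin_le_nhds (gt_mem_nhds one_pos)
  have hex : ∃ t ∈ T, ∃ᶠ ε : ℝ in nhdsWithin 0 (Set.Ioi 0), (1 - ε) • s + ε • m ∈ triSet t := by
    by_contra! hcon
    have hall := (Filter.eventually_all_finite hT.1).2
      fun t ht => hcon t ht
    obtain ⟨ε, h1, h2, h3⟩ := (hall.and (hpos.and hlt)).exists
    have hmem : (1 - ε) • s + ε • m ∈ convexHull ℝ P :=
      convex_convexHull ℝ P (subset_convexHull ℝ P hs) hm (by linarith) h2.le (by ring)
    rw [← hT.2.2.2.2] at hmem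
    simp only [Set.mem_iUnion] at hmem
    obtain ⟨t, ht, hx⟩ := hmem
    exact h1 t ht hx
  obtain ⟨t, ht, hfr⟩ := hex
  obtain ⟨ε, hε, hε'⟩ := (hfr.and_eventually hpos).exists
  exact ⟨t, ht, hT.mem_of_mem_triSet hgp ht hs
    ((isClosed_triSet t).mem_of_frequently_of_tendsto hfr hlim), ε, hε', hε⟩

/-! ### Useful edges span order-`k` triangles -/

lemma nonneg_of_not_pos_pair {x y x' y' : ℝ} (hd : 0 < x * y' - y * x') (h : y ≤ x)
    (h' : x' ≤ y') (hn : ¬ (0 < y ∧ 0 < x)) (hn' : ¬ (0 < y' ∧ 0 < x')) :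
    0 ≤ x ∧ y ≤ 0 ∧ x' ≤ 0 ∧ 0 ≤ y' := by
  have hy : y ≤ 0 := by
    by_contra! hy; exact hn ⟨hy, by linarith⟩
  have hx' : x' ≤ 0 := by
    by_contra! hx; exact hn' ⟨by linarith, hx⟩
  refine ⟨?_, hy, hx', ?_⟩
  · by_contra! hx; nlinarith [mul_nonneg (sub_nonneg.2 h) (neg_nonneg.2 hx')]
  · by_contra! hy'; nlinarith [mul_nonneg (sub_nonneg.2 h') (neg_nonneg.2 hy)]

/-- If `uv` is a side of a triangulation and `s` satisfies the minimality condition, then some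
triangle `s a b` of the triangulation has `u` and `v` in its cone at `s`, and neither `a` nor `b`
lies inside the circle through `u`, `v` and `s`. -/
lemma IsTriangulation.cone_of_edge {P : Set Pt} {T : Set (Finset Pt)} (hgp : GenPos P)
    (hT : IsTriangulation P T) {u v s z : Pt} {r : ℝ} {t₀ : Finset Pt} (ht₀ : t₀ ∈ T)
    (hut : u ∈ t₀) (hvt : v ∈ t₀) (hs : s ∈ P) (ho : 0 < orient v u s) (hpu : power z r u = 0)
    (hpv : power z r v = 0) (hps : power z r s = 0)
    (hmin : ∀ p ∈ P, 0 < orient v u p → 0 ≤ power z r p) :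
    ∃ a b, {s, a, b} ∈ T ∧ 0 < orient s a b ∧ 0 ≤ power z r a ∧ 0 ≤ power z r b ∧
      0 ≤ orient s u b ∧ 0 ≤ orient s v b ∧ 0 ≤ orient s a u ∧ 0 ≤ orient s a v := by
  have hu : u ∈ P := (hT.2.1 t₀ ht₀).2 hut
  have hv : v ∈ P := (hT.2.1 t₀ ht₀).2 hvt
  obtain ⟨hvu, hvs, hus⟩ := ne_of_orient_ne_zero ho.ne'
  have hm : (1 / 2 : ℝ) • u + (1 / 2 : ℝ) • v ∈ convexHull ℝ P :=
    convex_convexHull ℝ P (subset_convexHull ℝ P hu) (subset_convexHull ℝ P hv) (by norm_num)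
      (by norm_num) (by norm_num)
  obtain ⟨t, ht, hst, ε, hε, hmem⟩ := hT.exists_mem_ray hgp hs hm
  obtain ⟨a, b, haP, hbP, rfl, hab⟩ := hgp.exists_ccw_of_mem (hT.2.1 t ht).1 (hT.2.1 t ht).2 hst
  obtain ⟨hsa, hsb, -⟩ := ne_of_orient_ne_zero hab.ne'
  have hsvu : 0 < orient s v u := by rwa [← orient_rotate]
  have side : ∀ q ∈ ({s, a, b} : Finset Pt), q ∈ P → s ≠ q →
      ¬ (0 < orient s v q ∧ 0 < orient s q u) := by
    rintro q hqt hqP hsq ⟨q1, q2⟩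
    have hqv : q ≠ v := by rintro rfl; rw [orient_self_right] at q1; exact lt_irrefl _ q1
    have hqu : q ≠ u := by rintro rfl; rw [orient_self_right] at q2; exact lt_irrefl _ q2
    rcases lt_or_gt_of_ne (hgp.orient_ne_zero hv hu hqP hvu hqv.symm hqu.symm) with hq | hq
    · obtain ⟨y, hy, hy'⟩ := exists_mem_openSegments ho hq q1 q2
      refine hq.ne (hT.not_crossing hgp ht ht₀ ?_ hst hqt hut hvt hy hy')
      intro he
      have h4 : ({s, q, u, v} : Finset Pt) ⊆ {s, a, b} := by
        intro p hp
        simp only [Finset.mem_insert, Finset.mem_singleton] at hp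
        rcases hp with rfl | rfl | rfl | rfl
        · exact hst
        · exact hqt
        · exact he ▸ hut
        · exact he ▸ hvt
      have h5 := Finset.card_le_card h4
      have h6 : ({q, u, v} : Finset Pt).card = 3 :=
        card_triple (by rw [← orient_rotate, orient_swap]; exact neg_ne_zero.2 hq.ne)
      rw [card_triple hab.ne', Finset.card_insert_of_notMem (by simp [hsq, hvs.symm, hus.symm]),
        h6] at h5
      omega
    · have h1 := hmin q hqP hq
      have h2 : power z r q < 0 := power_neg_of_mem_triangle hsvu hps hpv hpu
        (by rw [← orient_rotate]; exact hq.le) q2.le q1.le hsq.symm hqv hqu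
      linarith
  have out : ∀ q ∈ ({s, a, b} : Finset Pt), q ∈ P → s ≠ q → 0 ≤ power z r q := by
    intro q hqt hqP hsq
    by_contra! hneg
    have hqv : q ≠ v := by rintro rfl; linarith
    have hqu : q ≠ u := by rintro rfl; linarith
    rcases lt_or_gt_of_ne (hgp.orient_ne_zero hv hu hqP hvu hqv.symm hqu.symm) with hq | hq
    · exact side q hqt hqP hsq (orient_pos_of_power_neg ho hpu hpv hps hneg hq)
    · have := hmin q hqP hq
      linarith
  obtain ⟨-, m2, m3⟩ := (mem_triSet_iff hab).1 hmem
  have n2 : 0 ≤ ε * (orient s u b + orient s v b) / 2 := by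
    refine m2.trans_eq ?_
    unfold orient; simp; ring
  have n3 : 0 ≤ ε * (orient s a u + orient s a v) / 2 := by
    refine m3.trans_eq ?_
    unfold orient; simp; ring
  have k2 : 0 ≤ orient s u b + orient s v b := by
    by_contra! h; nlinarith
  have k3 : 0 ≤ orient s a u + orient s a v := by
    by_contra! h; nlinarith
  have e1 := orient_swap_right s a v
  have e2 := orient_swap_right s b u
  have hd : 0 < orient s a u * orient s v b - orient s v a * orient s b u := by
    have : orient s a u * orient s v b - orient s v a * orient s b u =
      orient s a b * orient s v u := by unfold orient; ring
    rw [this]; positivity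
  obtain ⟨r1, r2, r3, r4⟩ := nonneg_of_not_pos_pair hd (by linarith) (by linarith)
    (side a (by simp) haP hsa) (side b (by simp) hbP hsb)
  exact ⟨a, b, ht, hab, out a (by simp) haP hsa, out b (by simp) hbP hsb, by linarith, r4, r1,
    by linarith⟩

lemma exists_circumcircle {u v s : Pt} (ho : 0 < orient v u s) :
    ∃ z r, 0 ≤ r ∧ dist u z = r ∧ dist v z = r ∧ dist s z = r := by
  obtain ⟨h1, h2⟩ := dist_circumcentre ho.ne'
  exact ⟨circumcentre v u s, _, dist_nonneg, h1, rfl, h2⟩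

lemma UsefulEdge.orderKTri {P : Set Pt} {k : ℕ} {u v s : Pt} (hgp : GenPos P)
    (h : UsefulEdge P k u v) (hs : s ∈ P) (ho : ccw v u s)
    (hmin : ∀ z : Pt, ∀ r : ℝ, dist u z = r → dist v z = r → dist s z = r →
      ∀ p ∈ P, ccw v u p → ¬ dist p z < r) : OrderKTri P k ({u, v, s} : Finset Pt) := by
  obtain ⟨T, ⟨hT, hk⟩, t₀, ht₀, hut, hvt⟩ := h
  have hu : u ∈ P := (hT.2.1 t₀ ht₀).2 hut
  have hv : v ∈ P := (hT.2.1 t₀ ht₀).2 hvt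
  change 0 < orient v u s at ho
  obtain ⟨z, r, hr, du, dv, ds⟩ := exists_circumcircle ho
  have hmin' : ∀ p ∈ P, 0 < orient v u p → 0 ≤ power z r p := fun p hp h =>
    (power_nonneg_iff hr).2 (hmin z r du dv ds p hp h)
  obtain ⟨a, b, ht, hab, pa, pb, c1, c2, c3, c4⟩ := hT.cone_of_edge hgp ht₀ hut hvt hs ho
    (power_eq_zero du) (power_eq_zero dv) (power_eq_zero ds) hmin'
  obtain ⟨z', r', hd, hcard⟩ := hk _ ht
  have hr' : 0 ≤ r' := by rw [← hd s (by simp)]; exact dist_nonneg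
  refine ⟨z, r, by simp [du, dv, ds], le_trans (Set.encard_le_encard ?_) hcard⟩
  rintro p ⟨hp, hpd⟩
  refine ⟨hp, ?_⟩
  rw [← power_neg_iff hr] at hpd
  rw [← power_neg_iff hr']
  have pu := power_eq_zero du
  have pv := power_eq_zero dv
  have ps := power_eq_zero ds
  have hpu : p ≠ u := by rintro rfl; linarith
  have hpv : p ≠ v := by rintro rfl; linarith
  obtain ⟨hvu, hvs, hus⟩ := ne_of_orient_ne_zero ho.ne'
  have hright : orient v u p < 0 := by
    rcases lt_or_gt_of_ne (hgp.orient_ne_zero hv hu hp hvu hpv.symm hpu.symm) with h | h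
    · exact h
    · have := hmin' p hp h
      linarith
  obtain ⟨q1, q2⟩ := orient_pos_of_power_neg ho pu pv ps hpd hright
  have hsvu : 0 < orient s v u := by rwa [← orient_rotate]
  have f1 : 0 ≤ orient s p b := by
    have e : orient s p b * orient s v u = orient s p u * orient s v b +
      orient s v p * orient s u b := by unfold orient; ring
    exact nonneg_of_mul_nonneg_left (by rw [e]; positivity) hsvu
  have f2 : 0 ≤ orient s a p := by
    have e : orient s a p * orient s v u = orient s p u * orient s a v +
      orient s v p * orient s a u := by unfold orient; ring
    exact nonneg_of_mul_nonneg_left (by rw [e]; positivity) hsvu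
  have hf := power_sub_comb z' z r' r s a b (barycentric_sum hab.ne' p)
  rw [← eq_barycentric hab.ne' p, ps, power_eq_zero (hd s (by simp)),
    power_eq_zero (hd a (by simp)), power_eq_zero (hd b (by simp))] at hf
  have g1 := mul_nonneg (div_nonneg f1 hab.le) pa
  have g2 := mul_nonneg (div_nonneg f2 hab.le) pb
  linarith

/-! ### The constrained Delaunay triangulation -/

/-- The triangles of the constrained Delaunay triangulation of `P` with constraint `uv`: the
segment `uv` does not meet their interior, and it hides all points of `P` that lie in their
circumdisk. -/
def IsCDTriangle (P : Set Pt) (u v : Pt) (t : Finset Pt) : Prop :=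
  t.card = 3 ∧ (t : Set Pt) ⊆ P ∧ (∀ y ∈ openSegment ℝ u v, y ∉ interior (triSet t)) ∧
  ∃ z r, 0 ≤ r ∧ (∀ p ∈ t, dist p z = r) ∧ ∀ p ∈ P, power z r p < 0 →
    ∀ x ∈ interior (triSet t), ∃ y ∈ openSegment ℝ u v, y ∈ openSegment ℝ x p

lemma IsCDTriangle.symm {P : Set Pt} {u v : Pt} {t : Finset Pt} (h : IsCDTriangle P u v t) :
    IsCDTriangle P v u t := by
  unfold IsCDTriangle
  rw [openSegment_symm]
  exact h

lemma orient_eq_zero_of_mem_openSegment {u v y : Pt} (hy : y ∈ openSegment ℝ u v) :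
    orient v u y = 0 := by
  obtain ⟨α, β, -, -, hs, rfl⟩ := hy
  rw [orient_comb _ _ _ _ hs, orient_self_right, orient_self_outer]; ring

lemma openSegment_subset_interior_triSet {t : Finset Pt} {x p : Pt}
    (hx : x ∈ interior (triSet t)) (hp : p ∈ triSet t) :
    openSegment ℝ x p ⊆ interior (triSet t) :=
  (convex_convexHull ℝ _ : Convex ℝ (triSet t)).openSegment_interior_self_subset_interior hx hp

lemma IsCDTriangle.mem_of_mem_triSet {P : Set Pt} (hgp : GenPos P) {u v : Pt} {t : Finset Pt}
    (h : IsCDTriangle P u v t) {p : Pt} (hp : p ∈ P) (hpt : p ∈ triSet t) : p ∈ t := by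
  obtain ⟨hc, hP, hcross, z, r, -, hd, hhid⟩ := h
  by_contra hn
  obtain ⟨a, b, c, -, -, -, rfl, ho⟩ := hgp.exists_ccw hc hP
  simp only [Finset.mem_insert, Finset.mem_singleton, not_or] at hn
  obtain ⟨x, hx⟩ := interior_triSet_nonempty ho
  obtain ⟨p1, p2, p3⟩ := (mem_triSet_iff ho).1 hpt
  have hneg : power z r p < 0 := power_neg_of_mem_triangle ho (power_eq_zero (hd a (by simp)))
    (power_eq_zero (hd b (by simp))) (power_eq_zero (hd c (by simp))) p1 p2 p3 hn.1 hn.2.1 hn.2.2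
  obtain ⟨y, hy, hy'⟩ := hhid p hp hneg x hx
  exact hcross y hy (openSegment_subset_interior_triSet hx hpt hy')

/-- A function that is affine on a triangle, nonpositive at the vertices and nonnegative at an
interior point vanishes at the vertices. -/
lemma eq_zero_of_comb_nonneg {α β γ x y z : ℝ} (hα : 0 < α) (hβ : 0 < β) (hγ : 0 < γ)
    (hx : x ≤ 0) (hy : y ≤ 0) (hz : z ≤ 0) (h : 0 ≤ α * x + β * y + γ * z) :
    x = 0 ∧ y = 0 ∧ z = 0 := by
  have h1 := mul_nonpos_of_nonneg_of_nonpos hα.le hx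
  have h2 := mul_nonpos_of_nonneg_of_nonpos hβ.le hy
  have h3 := mul_nonpos_of_nonneg_of_nonpos hγ.le hz
  exact ⟨(mul_eq_zero.1 (by linarith)).resolve_left hα.ne',
    (mul_eq_zero.1 (by linarith)).resolve_left hβ.ne',
    (mul_eq_zero.1 (by linarith)).resolve_left hγ.ne'⟩

/-- An interior point of a triangle is a positive combination of its vertices. -/
lemma exists_comb_of_mem_interior {a b c x : Pt} (ho : 0 < orient a b c)
    (hx : x ∈ interior (triSet {a, b, c})) : ∃ α β γ : ℝ, 0 < α ∧ 0 < β ∧ 0 < γ ∧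
      α + β + γ = 1 ∧ x = α • a + β • b + γ • c := by
  obtain ⟨h1, h2, h3⟩ := (mem_interior_triSet_iff ho).1 hx
  exact ⟨_, _, _, div_pos h1 ho, div_pos h2 ho, div_pos h3 ho, barycentric_sum ho.ne' x,
    eq_barycentric ho.ne' x⟩

lemma IsCDTriangle.power_nonneg {P : Set Pt} {u v x z : Pt} {r : ℝ} {t t' : Finset Pt}
    (h : IsCDTriangle P u v t) (hx : x ∈ interior (triSet t)) (hx' : x ∈ interior (triSet t'))
    (hhid : ∀ p ∈ P, power z r p < 0 → ∀ x ∈ interior (triSet t'),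
      ∃ y ∈ openSegment ℝ u v, y ∈ openSegment ℝ x p) {a : Pt} (ha : a ∈ t) :
    0 ≤ power z r a := by
  by_contra! hneg
  obtain ⟨y, hy, hy'⟩ := hhid a (h.2.1 ha) hneg x hx'
  exact h.2.2.1 y hy (openSegment_subset_interior_triSet hx (mem_triSet ha) hy')

/-- Constrained Delaunay triangles have pairwise disjoint interiors. -/
lemma IsCDTriangle.eq_of_mem_interior {P : Set Pt} (hgp : GenPos P) {u v x : Pt}
    {t t' : Finset Pt} (h : IsCDTriangle P u v t) (h' : IsCDTriangle P u v t')
    (hx : x ∈ interior (triSet t)) (hx' : x ∈ interior (triSet t')) : t = t' := by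
  obtain ⟨z, r, -, hd, hhid⟩ := h.2.2.2
  obtain ⟨z', r', -, hd', hhid'⟩ := h'.2.2.2
  have hp' : ∀ a ∈ t, power z r a - power z' r' a ≤ 0 := fun a ha => by
    rw [power_eq_zero (hd a ha)]
    linarith [h.power_nonneg hx hx' hhid' ha]
  have hp : ∀ a ∈ t', 0 ≤ power z r a - power z' r' a := fun a ha => by
    rw [power_eq_zero (hd' a ha)]
    linarith [h'.power_nonneg hx' hx hhid ha]
  obtain ⟨a, b, c, ha, hb, hc, rfl, ho⟩ := hgp.exists_ccw h.1 h.2.1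
  obtain ⟨a', b', c', ha', hb', hc', rfl, ho'⟩ := hgp.exists_ccw h'.1 h'.2.1
  have hfx : 0 ≤ power z r x - power z' r' x := by
    obtain ⟨α, β, γ, hα, hβ, hγ, hs, rfl⟩ := exists_comb_of_mem_interior ho' hx'
    rw [power_sub_comb _ _ _ _ _ _ _ hs]
    have := hp a' (by simp)
    have := hp b' (by simp)
    have := hp c' (by simp)
    positivity
  obtain ⟨α, β, γ, hα, hβ, hγ, hs, rfl⟩ := exists_comb_of_mem_interior ho hx
  rw [power_sub_comb _ _ _ _ _ _ _ hs] at hfx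
  obtain ⟨e1, e2, e3⟩ := eq_zero_of_comb_nonneg hα hβ hγ (hp' a (by simp)) (hp' b (by simp))
    (hp' c (by simp)) hfx
  obtain ⟨hab, hac, hbc⟩ := ne_of_orient_ne_zero ho'.ne'
  have hr : 0 ≤ r' := by rw [← hd' a' (by simp)]; exact dist_nonneg
  have mem : ∀ p ∈ ({a, b, c} : Finset Pt), p ∈ P → power z r p - power z' r' p = 0 →
      p ∈ ({a', b', c'} : Finset Pt) := by
    intro p hpt hpP he
    refine hgp.mem_of_concyclic ha' hb' hc' hpP hab hac hbc (hd' a' (by simp)) (hd' b' (by simp))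
      (hd' c' (by simp)) ?_
    rw [power_eq_zero (hd p hpt), power] at he
    exact (sq_eq_sq₀ dist_nonneg hr).1 (by linarith)
  refine Finset.eq_of_subset_of_card_le ?_ (by rw [h.1, h'.1])
  intro p hpt
  have hpt' := hpt
  simp only [Finset.mem_insert, Finset.mem_singleton] at hpt'
  rcases hpt' with rfl | rfl | rfl
  · exact mem _ hpt ha e1
  · exact mem _ hpt hb e2
  · exact mem _ hpt hc e3

lemma IsCDTriangle.orderKTri {P : Set Pt} (hgp : GenPos P) {k : ℕ} {u v s x : Pt} (hu : u ∈ P)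
    (hv : v ∈ P) (huv : u ≠ v) {t : Finset Pt} (h : IsCDTriangle P u v t)
    (hx : x ∈ interior (triSet t)) (hxl : 0 < orient v u x)
    (hk : OrderKTri P k ({u, v, s} : Finset Pt))
    (hmin : ∀ z : Pt, ∀ r : ℝ, dist u z = r → dist v z = r → dist s z = r →
      ∀ p ∈ P, ccw v u p → ¬ dist p z < r) : OrderKTri P k t := by
  obtain ⟨hc, hP, -, z, r, hr, hd, hhid⟩ := h
  obtain ⟨z', r', hd', hcard⟩ := hk
  have hr' : 0 ≤ r' := by rw [← hd' u (by simp)]; exact dist_nonneg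
  refine ⟨z, r, hd, le_trans (Set.encard_le_encard ?_) hcard⟩
  rintro p ⟨hp, hpd⟩
  refine ⟨hp, ?_⟩
  rw [← power_neg_iff hr] at hpd
  rw [← power_neg_iff hr']
  have right : ∀ q ∈ P, power z r q < 0 → orient v u q < 0 := by
    intro q hq hqd
    obtain ⟨y, hy, α, β, hα, hβ, hs, rfl⟩ := hhid q hq hqd x hx
    have := orient_eq_zero_of_mem_openSegment hy
    rw [orient_comb _ _ _ _ hs] at this
    by_contra! hn
    have := mul_pos hα hxl
    have := mul_nonneg hβ.le hn
    linarith
  have hpr := right p hp hpd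
  have left : ∀ y ∈ triSet t, 0 ≤ orient v u y := by
    have hcl : IsClosed {y : Pt | 0 ≤ orient v u y} :=
      isClosed_le continuous_const (continuous_orient v u)
    have hin : interior (triSet t) ⊆ {y : Pt | 0 ≤ orient v u y} := by
      intro w hw
      obtain ⟨y, hy, α, β, hα, hβ, hs, rfl⟩ := hhid p hp hpd w hw
      have := orient_eq_zero_of_mem_openSegment hy
      rw [orient_comb _ _ _ _ hs] at this
      by_contra hn
      have hn' : orient v u w < 0 := not_le.1 hn
      have := mul_neg_of_pos_of_neg hα hn'
      have := mul_neg_of_pos_of_neg hβ hpr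
      linarith
    obtain ⟨a, b, c, -, -, -, rfl, ho⟩ := hgp.exists_ccw hc hP
    exact fun y hy => closure_minimal hin hcl (triSet_subset_closure_interior ho hy)
  have pu := power_eq_zero (hd' u (by simp))
  have pv := power_eq_zero (hd' v (by simp))
  have vert : ∀ a ∈ t, 0 ≤ power z' r' a - power z r a := by
    intro a ha
    rw [power_eq_zero (hd a ha), sub_zero]
    by_cases hau : a = u
    · rw [hau, pu]
    by_cases hav : a = v
    · rw [hav, pv]
    exact (power_nonneg_iff hr').2 (hmin z' r' (hd' u (by simp)) (hd' v (by simp))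
      (hd' s (by simp)) a (hP ha) ((left a (mem_triSet ha)).lt_of_ne
      (hgp.orient_ne_zero hv hu (hP ha) huv.symm (Ne.symm hav) (Ne.symm hau)).symm))
  have hfx : 0 ≤ power z' r' x - power z r x := by
    obtain ⟨a, b, c, -, -, -, rfl, ho⟩ := hgp.exists_ccw hc hP
    obtain ⟨α, β, γ, hα, hβ, hγ, hs, rfl⟩ := exists_comb_of_mem_interior ho hx
    rw [power_sub_comb _ _ _ _ _ _ _ hs]
    have := vert a (by simp)
    have := vert b (by simp)
    have := vert c (by simp)
    positivity
  have qu : 0 ≤ power z r u := by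
    by_contra! hn
    have := right u hu hn
    rw [orient_self_right] at this
    exact lt_irrefl _ this
  have qv : 0 ≤ power z r v := by
    by_contra! hn
    have := right v hv hn
    rw [orient_self_outer] at this
    exact lt_irrefl _ this
  obtain ⟨y, ⟨γ, δ, hγ, hδ, hs', he⟩, α, β, hα, hβ, hs, rfl⟩ := hhid p hp hpd x hx
  have e1 := power_sub_comb_two z' z r' r x p hs
  rw [← he, power_sub_comb_two z' z r' r u v hs', pu, pv] at e1
  have k1 := mul_nonneg hα.le hfx
  have k2 := mul_nonneg hγ.le qu
  have k3 := mul_nonneg hδ.le qv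
  have k4 : β * (power z' r' p - power z r p) ≤ 0 := by linarith
  have := nonpos_of_mul_nonpos_right k4 hβ
  linarith

lemma power_neg_of_mem_interior {z a b c x : Pt} {r : ℝ} (ho : 0 < orient a b c)
    (ha : dist a z = r) (hb : dist b z = r) (hc : dist c z = r)
    (hx : x ∈ interior (triSet {a, b, c})) : power z r x < 0 := by
  obtain ⟨h1, h2, h3⟩ := (mem_interior_triSet_iff ho).1 hx
  refine power_neg_of_mem_triangle ho (power_eq_zero ha) (power_eq_zero hb) (power_eq_zero hc)
    h1.le h2.le h3.le ?_ ?_ ?_ <;> rintro rfl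
  · rw [orient_self_outer] at h3; exact lt_irrefl _ h3
  · rw [orient_self_right] at h3; exact lt_irrefl _ h3
  · rw [orient_self_right] at h2; exact lt_irrefl _ h2

/-- The part of the line through `u` and `v` inside a disk lies in the open segment `uv` as soon
as the disk meets this open segment and contains neither `u` nor `v`. -/
lemma mem_openSegment_of_power_neg {z u v y y₀ : Pt} {r : ℝ} (huv : u ≠ v) (hu : 0 ≤ power z r u)
    (hv : 0 ≤ power z r v) (hy₀ : y₀ ∈ openSegment ℝ u v) (hn₀ : power z r y₀ < 0)
    (hy : orient v u y = 0) (hn : power z r y < 0) : y ∈ openSegment ℝ u v := by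
  rw [orient_swap, neg_eq_zero] at hy
  obtain ⟨σ, rfl⟩ := exists_comb_of_orient_eq_zero huv hy
  obtain ⟨α, τ, hα, hτ, hs, rfl⟩ := hy₀
  obtain rfl : α = 1 - τ := by linarith
  have h0 : 0 < σ := by
    by_contra! h
    have hd : 0 < τ - σ := by linarith
    have e : u = (τ / (τ - σ)) • ((1 - σ) • u + σ • v) +
        (-σ / (τ - σ)) • ((1 - τ) • u + τ • v) := by
      apply Pt.ext' <;> simp only [comb_two_apply] <;> field_simp <;> ring
    have hlt := power_neg_of_comb_two (z := z) (r := r)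
      (by field_simp; ring : τ / (τ - σ) + -σ / (τ - σ) = 1)
      (div_pos hτ hd) (div_nonneg (by linarith) hd.le) hn hn₀.le
    rw [← e] at hlt
    linarith
  have h1 : σ < 1 := by
    by_contra! h
    have hd : 0 < σ - τ := by linarith
    have e : v = ((1 - τ) / (σ - τ)) • ((1 - σ) • u + σ • v) +
        ((σ - 1) / (σ - τ)) • ((1 - τ) • u + τ • v) := by
      apply Pt.ext' <;> simp only [comb_two_apply] <;> field_simp <;> ring
    have hlt := power_neg_of_comb_two (z := z) (r := r)
      (by field_simp; ring : (1 - τ) / (σ - τ) + (σ - 1) / (σ - τ) = 1)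
      (div_pos hα hd) (div_nonneg (by linarith) hd.le) hn hn₀.le
    rw [← e] at hlt
    linarith
  exact ⟨_, _, by linarith, h0, by ring, rfl⟩

lemma exists_mem_openSegments_of_power_neg {z u v x p y₀ : Pt} {r : ℝ} (huv : u ≠ v)
    (hu : 0 ≤ power z r u) (hv : 0 ≤ power z r v) (hy₀ : y₀ ∈ openSegment ℝ u v)
    (hn₀ : power z r y₀ < 0) (hx : 0 < orient v u x) (hxn : power z r x < 0)
    (hp : orient v u p < 0) (hpn : power z r p ≤ 0) :
    ∃ y ∈ openSegment ℝ u v, y ∈ openSegment ℝ x p ∧ power z r y < 0 := by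
  obtain ⟨y, hy, hy0⟩ := exists_mem_openSegment_orient_eq_zero hx hp
  have hn : power z r y < 0 := by
    obtain ⟨α, β, hα, hβ, hs, rfl⟩ := hy
    exact power_neg_of_comb_two hs hα hβ.le hxn hpn
  exact ⟨y, mem_openSegment_of_power_neg huv hu hv hy₀ hn₀ hy0 hn, hy, hn⟩

lemma orient_pos_of_mem_interior {u v w a b c x : Pt} (ho : 0 < orient a b c)
    (hw : orient v u w ≠ 0)
    (ha : 0 ≤ orient v u a) (hb : 0 ≤ orient v u b) (hc : 0 ≤ orient v u c)
    (hx : x ∈ interior (triSet {a, b, c})) : 0 < orient v u x := by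
  obtain ⟨α, β, γ, hα, hβ, hγ, hs, rfl⟩ := exists_comb_of_mem_interior ho hx
  have h1 := mul_nonneg hα.le ha
  have h2 := mul_nonneg hβ.le hb
  have h3 := mul_nonneg hγ.le hc
  rw [orient_comb_three _ _ _ _ _ hs]
  by_contra! h
  have ea := (mul_eq_zero.1 (by linarith : α * orient v u a = 0)).resolve_left hα.ne'
  have eb := (mul_eq_zero.1 (by linarith : β * orient v u b = 0)).resolve_left hβ.ne'
  have ec := (mul_eq_zero.1 (by linarith : γ * orient v u c = 0)).resolve_left hγ.ne'
  apply hw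
  rw [eq_barycentric ho.ne' w, orient_comb_three _ _ _ _ _ (barycentric_sum ho.ne' w), ea, eb, ec]
  ring

/-- A triangle on the closed left side of `uv` whose circumdisk contains no point of that side and
meets the open segment `uv` is a constrained Delaunay triangle. -/
lemma isCDTriangle_of_left {P : Set Pt} {u v w a b c z y₀ : Pt} {r : ℝ} (hu : u ∈ P) (hv : v ∈ P)
    (huv : u ≠ v) (haP : a ∈ P) (hbP : b ∈ P) (hcP : c ∈ P) (ho : 0 < orient a b c)
    (ha : 0 ≤ orient v u a) (hb : 0 ≤ orient v u b) (hc : 0 ≤ orient v u c)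
    (hw : orient v u w ≠ 0) (hr : 0 ≤ r) (da : dist a z = r) (db : dist b z = r)
    (dc : dist c z = r) (hemp : ∀ p ∈ P, 0 ≤ orient v u p → 0 ≤ power z r p)
    (hy₀ : y₀ ∈ openSegment ℝ u v) (hn₀ : power z r y₀ < 0) : IsCDTriangle P u v {a, b, c} := by
  refine ⟨card_triple ho.ne', ?_, ?_, z, r, hr, by simp [da, db, dc], ?_⟩
  · simp [Set.insert_subset_iff, haP, hbP, hcP]
  · intro y hy hyi
    exact (orient_pos_of_mem_interior ho hw ha hb hc hyi).ne'
      (orient_eq_zero_of_mem_openSegment hy)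
  · intro p hp hpn x hx
    have hpo : orient v u p < 0 := by
      by_contra! h
      exact absurd hpn (hemp p hp h).not_gt
    obtain ⟨y, hy, hy', -⟩ := exists_mem_openSegments_of_power_neg huv
      (hemp u hu (orient_self_right _ _).ge) (hemp v hv (orient_self_outer _ _).ge) hy₀ hn₀
      (orient_pos_of_mem_interior ho hw ha hb hc hx) (power_neg_of_mem_interior ho da db dc hx)
      hpo hpn.le
    exact ⟨y, hy, hy'⟩

lemma isCDTriangle_of_min {P : Set Pt} (hgp : GenPos P) {u v s : Pt} (hu : u ∈ P) (hv : v ∈ P)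
    (huv : u ≠ v) (hsP : s ∈ P) (ho : 0 < orient v u s)
    (hmin : ∀ z : Pt, ∀ r : ℝ, dist u z = r → dist v z = r → dist s z = r →
      ∀ p ∈ P, ccw v u p → ¬ dist p z < r) : IsCDTriangle P u v {u, v, s} := by
  obtain ⟨z, r, hr, du, dv, ds⟩ := exists_circumcircle ho
  rw [Finset.insert_comm]
  have pu := power_eq_zero du
  have pv := power_eq_zero dv
  refine isCDTriangle_of_left (y₀ := (1 / 2 : ℝ) • u + (1 / 2 : ℝ) • v) hu hv huv hv hu hsP ho
    (orient_self_outer _ _).ge (orient_self_right _ _).ge ho.le ho.ne' hr dv du ds ?_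
    ⟨1 / 2, 1 / 2, by norm_num, by norm_num, by norm_num, rfl⟩ ?_
  · intro p hp hpo
    by_cases hpu : p = u
    · rw [hpu, pu]
    by_cases hpv : p = v
    · rw [hpv, pv]
    exact (power_nonneg_iff hr).2 (hmin z r du dv ds p hp (hpo.lt_of_ne
      (hgp.orient_ne_zero hv hu hp huv.symm (Ne.symm hpv) (Ne.symm hpu)).symm))
  · have := power_comb z r u v u (by norm_num : (1 / 2 : ℝ) + 1 / 2 + 0 = 1)
    rw [zero_smul, add_zero] at this
    rw [this, pu, pv]
    have := power_zero_pos huv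
    linarith

/-- Constrained Delaunay triangles cover the generic points of the convex hull on the left. -/
lemma Generic.exists_isCDTriangle_of_left {P : Set Pt} (hfin : P.Finite) (hgp : GenPos P)
    {u v x : Pt} (hu : u ∈ P) (hv : v ∈ P) (huv : u ≠ v) (hx : Generic P x)
    (hxP : x ∈ convexHull ℝ P) (hxl : 0 < orient v u x) :
    ∃ t, IsCDTriangle P u v t ∧ x ∈ triSet t := by
  obtain ⟨a, ha, b, hb, c, hc, ho, hxi, z, r, hr, da, db, dc, hemp⟩ :=
    hx.exists_delaunay hfin hgp hxP
  by_cases hcross : ∀ y ∈ openSegment ℝ u v, y ∉ interior (triSet {a, b, c})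
  · exact ⟨{a, b, c}, ⟨card_triple ho.ne', by simp [Set.insert_subset_iff, ha, hb, hc], hcross,
      z, r, hr, by simp [da, db, dc], fun p hp hpn => absurd hpn (hemp p hp).not_gt⟩,
      interior_subset hxi⟩
  push Not at hcross
  obtain ⟨y₀, hy₀, hyi⟩ := hcross
  have hn₀ := power_neg_of_mem_interior ho da db dc hyi
  have hxn := power_neg_of_mem_interior ho da db dc hxi
  have cross : ∀ q, dist q z = r → orient v u q < 0 →
      ∃ y ∈ openSegment ℝ u v, y ∈ openSegment ℝ x q ∧ power z r y < 0 := fun q hq hqo =>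
    exists_mem_openSegments_of_power_neg huv (hemp u hu) (hemp v hv) hy₀ hn₀ hxl hxn hqo
      (power_eq_zero hq).le
  set L : Set Pt := {p ∈ P | 0 ≤ orient v u p} with hL
  have hLP : L ⊆ P := Set.sep_subset _ _
  have huL : u ∈ L := ⟨hu, (orient_self_right _ _).ge⟩
  have hvL : v ∈ L := ⟨hv, (orient_self_outer _ _).ge⟩
  have hsegL : openSegment ℝ u v ⊆ convexHull ℝ L := (convex_convexHull ℝ L).openSegment_subset
    (subset_convexHull ℝ L huL) (subset_convexHull ℝ L hvL)
  have hxL : x ∈ convexHull ℝ L := by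
    by_contra hxL
    obtain ⟨f, m, hfx, hf⟩ := geometric_hahn_banach_point_closed (convex_convexHull ℝ L)
      ((hfin.subset hLP).isCompact_convexHull ℝ).isClosed hxL
    have key : ∀ q ∈ P, dist q z = r → f x < f q := by
      intro q hq hqd
      by_cases hqo : 0 ≤ orient v u q
      · exact hfx.trans (hf q (subset_convexHull ℝ L ⟨hq, hqo⟩))
      · obtain ⟨y, hy, ⟨α, β, hα, hβ, hs, rfl⟩, -⟩ := cross q hqd (not_le.1 hqo)
        have hlt := hfx.trans (hf _ (hsegL hy))
        rw [map_add, map_smul, map_smul, smul_eq_mul, smul_eq_mul] at hlt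
        obtain rfl : α = 1 - β := by linarith
        nlinarith
    obtain ⟨α, β, γ, hα, hβ, hγ, hs, hxe⟩ := exists_comb_of_mem_interior ho hxi
    have hfe : f x = α * f a + β * f b + γ * f c := by
      conv_lhs => rw [hxe]
      simp
    have h1 := mul_lt_mul_of_pos_left (key a ha da) hα
    have h2 := mul_lt_mul_of_pos_left (key b hb db) hβ
    have h3 := mul_lt_mul_of_pos_left (key c hc dc) hγ
    have h4 : f x = α * f x + β * f x + γ * f x := by rw [← add_mul, ← add_mul, hs, one_mul]
    linarith
  obtain ⟨a', ha', b', hb', c', hc', ho', hxi', z', r', hr', da', db', dc', hemp'⟩ :=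
    (hx.mono hLP).exists_delaunay (hfin.subset hLP) (hgp.mono hLP) hxL
  refine ⟨{a', b', c'}, ?_, interior_subset hxi'⟩
  by_cases hseg : ∃ y ∈ openSegment ℝ u v, power z' r' y < 0
  · obtain ⟨y, hy, hn⟩ := hseg
    exact isCDTriangle_of_left (w := x) hu hv huv ha'.1 hb'.1 hc'.1 ho' ha'.2 hb'.2 hc'.2 hxl.ne'
      hr' da' db' dc' (fun p hp hpo => hemp' p ⟨hp, hpo⟩) hy hn
  push Not at hseg
  exfalso
  have hfx : 0 ≤ power z r x - power z' r' x := by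
    obtain ⟨α, β, γ, hα, hβ, hγ, hs, rfl⟩ := exists_comb_of_mem_interior ho' hxi'
    rw [power_sub_comb _ _ _ _ _ _ _ hs, power_eq_zero da', power_eq_zero db', power_eq_zero dc']
    have := hemp _ ha'.1
    have := hemp _ hb'.1
    have := hemp _ hc'.1
    simp only [sub_zero]
    positivity
  have vert : ∀ q ∈ P, dist q z = r → power z r q - power z' r' q ≤ 0 := by
    intro q hq hqd
    by_cases hqo : 0 ≤ orient v u q
    · rw [power_eq_zero hqd]
      linarith [hemp' q ⟨hq, hqo⟩]
    · obtain ⟨y, hy, ⟨α, β, hα, hβ, hs, rfl⟩, hyn⟩ := cross q hqd (not_le.1 hqo)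
      have e := power_sub_comb_two z z' r r' x q hs
      have h1 := hseg _ hy
      have h2 := mul_nonneg hα.le hfx
      exact nonpos_of_mul_nonpos_right (by linarith :
        β * (power z r q - power z' r' q) ≤ 0) hβ
  obtain ⟨α, β, γ, hα, hβ, hγ, hs, rfl⟩ := exists_comb_of_mem_interior ho hxi
  rw [power_sub_comb _ _ _ _ _ _ _ hs] at hfx
  obtain ⟨e1, e2, e3⟩ := eq_zero_of_comb_nonneg hα hβ hγ (vert a ha da) (vert b hb db)
    (vert c hc dc) hfx
  obtain ⟨α', β', γ', -, -, -, hs', rfl⟩ := exists_comb_of_mem_interior ho hyi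
  have e := power_sub_comb z z' r r' a b c hs'
  rw [e1, e2, e3] at e
  linarith [hseg _ hy₀]

lemma Generic.exists_isCDTriangle {P : Set Pt} (hfin : P.Finite) (hgp : GenPos P)
    {u v x : Pt} (hu : u ∈ P) (hv : v ∈ P) (huv : u ≠ v) (hx : Generic P x)
    (hxP : x ∈ convexHull ℝ P) : ∃ t, IsCDTriangle P u v t ∧ x ∈ triSet t := by
  rcases lt_or_gt_of_ne (hx.2 v hv u hu huv.symm) with h | h
  · obtain ⟨t, ht, hxt⟩ := hx.exists_isCDTriangle_of_left hfin hgp hv hu huv.symm hxP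
      (by rw [orient_swap]; linarith)
    exact ⟨t, ht.symm, hxt⟩
  · exact hx.exists_isCDTriangle_of_left hfin hgp hu hv huv hxP h

lemma dense_setOf_orient_ne_zero {p q : Pt} (hpq : p ≠ q) : Dense {x | orient p q x ≠ 0} := by
  intro x
  by_cases hx : orient p q x = 0
  swap
  · exact subset_closure hx
  set w : Pt := !₂[p 0 - (q 1 - p 1), p 1 + (q 0 - p 0)] with hw
  have hwp : 0 < orient p q w := by
    have := power_zero_pos hpq
    simp only [power_eq] at this
    simp only [orient, hw, Matrix.cons_val_zero, Matrix.cons_val_one]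
    linarith
  have hseg : openSegment ℝ x w ⊆ {x | orient p q x ≠ 0} := by
    rintro y ⟨α, β, -, hβ, hs, rfl⟩
    change orient p q _ ≠ 0
    rw [orient_comb _ _ _ _ hs, hx]
    have := mul_pos hβ hwp
    linarith
  exact closure_mono hseg (segment_subset_closure_openSegment (left_mem_segment ℝ x w))

lemma isOpen_setOf_orient_ne_zero (p q : Pt) : IsOpen {x | orient p q x ≠ 0} :=
  isOpen_ne_fun (continuous_orient p q) continuous_const

lemma dense_setOf_generic {P : Set Pt} (hfin : P.Finite) : Dense {x | Generic P x} := by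
  have h1 : Dense (⋂ e ∈ {e ∈ P ×ˢ P | e.1 ≠ e.2}, {x : Pt | orient e.1 e.2 x ≠ 0}) :=
    dense_biInter_of_isOpen (fun e _ => isOpen_setOf_orient_ne_zero e.1 e.2)
      ((hfin.prod hfin).subset (Set.sep_subset _ _)).countable
      (fun e he => dense_setOf_orient_ne_zero he.2)
  refine ((hfin.countable.dense_compl ℝ).inter_of_isOpen_left h1 hfin.isClosed.isOpen_compl).mono ?_
  rintro x ⟨hx, hx'⟩
  refine ⟨hx, fun p hp q hq hpq => ?_⟩
  simp only [Set.mem_iInter] at hx'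
  exact hx' (p, q) ⟨⟨hp, hq⟩, hpq⟩

lemma finite_setOf_isCDTriangle {P : Set Pt} (hfin : P.Finite) (u v : Pt) :
    {t | IsCDTriangle P u v t}.Finite := by
  refine (hfin.toFinset.powerset : Finset (Finset Pt)).finite_toSet.subset fun t ht => ?_
  rw [Finset.mem_coe, Finset.mem_powerset]
  exact fun p hp => hfin.mem_toFinset.2 (ht.2.1 hp)

lemma iUnion_isCDTriangle {P : Set Pt} (hfin : P.Finite) (hgp : GenPos P) {u v s : Pt} (hu : u ∈ P)
    (hv : v ∈ P) (huv : u ≠ v) (hs : s ∈ P) (ho : 0 < orient v u s) :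
    ⋃ t ∈ {t | IsCDTriangle P u v t}, triSet t = convexHull ℝ P := by
  apply Set.Subset.antisymm
  · exact Set.iUnion₂_subset fun t ht => convexHull_mono ht.2.1
  have hint : (interior (convexHull ℝ P)).Nonempty :=
    (interior_triSet_nonempty ho).mono (interior_mono (convexHull_mono
      (by simp [Set.insert_subset_iff, hu, hv, hs])))
  have hcl : IsClosed (⋃ t ∈ {t | IsCDTriangle P u v t}, triSet t) :=
    (finite_setOf_isCDTriangle hfin u v).isClosed_biUnion fun t _ => isClosed_triSet t
  calc convexHull ℝ P ⊆ closure (interior (convexHull ℝ P)) := by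
        rw [(convex_convexHull ℝ P).closure_interior_eq_closure_of_nonempty_interior hint]
        exact subset_closure
    _ ⊆ closure (interior (convexHull ℝ P) ∩ {x | Generic P x}) :=
        closure_minimal ((dense_setOf_generic hfin).open_subset_closure_inter isOpen_interior)
          isClosed_closure
    _ ⊆ ⋃ t ∈ {t | IsCDTriangle P u v t}, triSet t := by
        refine closure_minimal ?_ hcl
        rintro x ⟨hxi, hx⟩
        obtain ⟨t, ht, hxt⟩ := hx.exists_isCDTriangle hfin hgp hu hv huv (interior_subset hxi)
        exact Set.mem_biUnion ht hxt

/-- The constrained Delaunay triangulation is a triangulation. -/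
lemma isTriangulation_isCDTriangle {P : Set Pt} (hfin : P.Finite) (hgp : GenPos P) {u v s : Pt}
    (hu : u ∈ P) (hv : v ∈ P) (huv : u ≠ v) (hs : s ∈ P) (ho : 0 < orient v u s) :
    IsTriangulation P {t | IsCDTriangle P u v t} := by
  have hun := iUnion_isCDTriangle hfin hgp hu hv huv hs ho
  refine ⟨finite_setOf_isCDTriangle hfin u v, fun t ht => ⟨ht.1, ht.2.1⟩, fun p hp => ?_, ?_, hun⟩
  · have hpc := subset_convexHull ℝ P hp
    rw [← hun] at hpc
    obtain ⟨t, ht, hpt⟩ := Set.mem_iUnion₂.1 hpc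
    exact ⟨t, ht, ht.mem_of_mem_triSet hgp hp hpt⟩
  · intro t ht t' ht' hne
    rw [Set.eq_empty_iff_forall_notMem]
    rintro x ⟨hx, hx'⟩
    exact hne (ht.eq_of_mem_interior hgp ht' hx hx')

lemma IsCDTriangle.exists_mem_interior {P : Set Pt} (hgp : GenPos P) {u v : Pt} (hu : u ∈ P)
    (hv : v ∈ P) (huv : u ≠ v) {t : Finset Pt} (h : IsCDTriangle P u v t) :
    ∃ x ∈ interior (triSet t), orient v u x ≠ 0 := by
  obtain ⟨a, hat, ha⟩ : ∃ a ∈ t, a ∉ ({u, v} : Finset Pt) := by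
    by_contra! hsub
    have := Finset.card_le_card (show t ⊆ {u, v} from hsub)
    rw [h.1, Finset.card_pair huv] at this
    omega
  simp only [Finset.mem_insert, Finset.mem_singleton, not_or] at ha
  have hao := hgp.orient_ne_zero hv hu (h.2.1 hat) huv.symm (Ne.symm ha.2) (Ne.symm ha.1)
  obtain ⟨x, hx⟩ : (interior (triSet t)).Nonempty := by
    obtain ⟨a, b, c, -, -, -, rfl, ho⟩ := hgp.exists_ccw h.1 h.2.1
    exact interior_triSet_nonempty ho
  by_cases hx0 : orient v u x = 0
  · refine ⟨(1 / 2 : ℝ) • x + (1 / 2 : ℝ) • a, openSegment_subset_interior_triSet hx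
      (mem_triSet hat) ⟨1 / 2, 1 / 2, by norm_num, by norm_num, by norm_num, rfl⟩, ?_⟩
    rw [orient_comb _ _ _ _ (by norm_num), hx0]
    simpa using hao
  · exact ⟨x, hx, hx0⟩

/-- Lemma 2.4 (useful edge test): with `s₁` the point of `P` strictly to the left of the
directed line from `v` to `u` whose circumdisk `C(u,v,s₁)` contains no point of `P`
strictly to the left of that line, and `s₂` defined analogously on the right,
`{u,v}` is a useful order-`k` Delaunay edge iff the triangles `u v s₁` and `u v s₂`
are order-`k` Delaunay triangles. -/
theorem usefulEdge_iff_orderKTri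
    (P : Set Pt) (hfin : P.Finite) (hgp : GenPos P) (k : ℕ)
    (u v s₁ s₂ : Pt) (hu : u ∈ P) (hv : v ∈ P) (huv : u ≠ v)
    (hedge : OrderKEdge P k u v)
    (hs₁P : s₁ ∈ P) (hs₁L : ccw v u s₁)
    (hs₁min : ∀ z : Pt, ∀ r : ℝ, dist u z = r → dist v z = r → dist s₁ z = r →
      ∀ p ∈ P, ccw v u p → ¬ dist p z < r)
    (hs₂P : s₂ ∈ P) (hs₂R : ccw u v s₂)
    (hs₂min : ∀ z : Pt, ∀ r : ℝ, dist u z = r → dist v z = r → dist s₂ z = r →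
      ∀ p ∈ P, ccw u v p → ¬ dist p z < r) :
    UsefulEdge P k u v ↔
      OrderKTri P k ({u, v, s₁} : Finset Pt) ∧ OrderKTri P k ({u, v, s₂} : Finset Pt) := by
  constructor
  · intro h
    have h' : UsefulEdge P k v u := by
      obtain ⟨T, hT, t, ht, htu, htv⟩ := h
      exact ⟨T, hT, t, ht, htv, htu⟩
    refine ⟨h.orderKTri hgp hs₁P hs₁L hs₁min, ?_⟩
    rw [Finset.insert_comm]
    exact h'.orderKTri hgp hs₂P hs₂R fun z r hv hu => hs₂min z r hu hv
  · rintro ⟨h₁, h₂⟩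
    refine ⟨{t | IsCDTriangle P u v t}, ⟨isTriangulation_isCDTriangle hfin hgp hu hv huv hs₁P hs₁L,
      fun t ht => ?_⟩, {u, v, s₁}, isCDTriangle_of_min hgp hu hv huv hs₁P hs₁L hs₁min, by simp,
      by simp⟩
    obtain ⟨x, hx, hx0⟩ := ht.exists_mem_interior hgp hu hv huv
    rcases lt_or_gt_of_ne hx0 with hlt | hgt
    · rw [Finset.insert_comm] at h₂
      exact ht.symm.orderKTri hgp hv hu huv.symm hx (by rw [orient_swap]; linarith) h₂
        fun z r hv hu => hs₂min z r hu hv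
    · exact ht.orderKTri hgp hu hv huv hx hgt h₁ hs₁min

end
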